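/- Let f_B ∈ (RatFunc ℚ)[x] be the polynomial f_B(s,x) = 3x^12 + 100x^11 + 1350x^10 + 9300x^9 + 32925x^8 + 45000x^7 - 43500x^6 - 147000x^5 + 46125x^4 + 172500x^3 - 16250x^2 + 22500x + 1875 - s·2^11·5^2·x^2, where s denotes the generator of the rational function field ℚ(s). Then the Galois group of f_B over ℚ(s) (i.e., the Galois group of its splitting field over ℚ(s)) has cardinality 95040 (the order of the Mathieu group M₁₂). -/

import Mathlib

open Polynomial

namespace FB

def lowBits (k n : ℕ) : ℕ := Nat.land n (Nat.sub (Nat.pow 2 k) 1)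

def powMod (k x : ℕ) : ℕ → ℕ
  | 0 => 1
  | n + 1 => lowBits k (Nat.mul x (powMod k x n))

def termMod (k : ℕ) : List ℕ → List ℕ → ℕ
  | x :: xs, e :: es => lowBits k (Nat.mul (powMod k x e) (termMod k xs es))
  | _, _ => 1

def scaleMod (k t : ℕ) : ℤ → ℕ
  | Int.ofNat a => Nat.mul a t
  | Int.negSucc a => Nat.mul (Nat.succ a) (Nat.sub (Nat.pow 2 k) t)

def evalMod (k : ℕ) (x : List ℕ) : List (ℤ × List ℕ) → ℕ
  | [] => 0
  | (c, e) :: ts => lowBits k (Nat.add (scaleMod k (termMod k x e) c) (evalMod k x ts))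

def fStar : List (ℤ × List ℕ) :=
  [(332150625, [12, 0]), (1328602500, [11, 1]), (-319848750, [10, 2]), (1131772500, [9, 3]),
    (100875375, [8, 4]), (-107163000, [7, 5]), (-10570500, [6, 6]), (3645000, [5, 7]),
    (888975, [4, 8]), (83700, [3, 9]), (4050, [2, 10]), (100, [1, 11]), (1, [0, 12]), (-1, [0, 2])]

def gStar : List (ℤ × List ℕ) :=
  [(332150625, [0, 0]), (1328602500, [5, 1]), (-319848750, [10, 2]), (1131772500, [15, 3]),
    (100875375, [20, 4]), (-107163000, [25, 5]), (-10570500, [30, 6]), (3645000, [35, 7]),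
    (888975, [40, 8]), (83700, [45, 9]), (4050, [50, 10]), (100, [55, 11]), (1, [60, 12]),
    (-1, [0, 2])]

def derivTerms : List (ℤ × List ℕ) → List (ℤ × List ℕ)
  | (c, [i, j + 1]) :: ts => (c * (j + 1 : ℕ), [i, j]) :: derivTerms ts
  | _ :: ts => derivTerms ts
  | [] => []

def newtonStep (b : ℕ) (ts : List (ℤ × List ℕ)) (k : ℕ) (yd : ℕ × ℕ) : ℕ × ℕ :=
  match yd with
  | (y, d) =>
    let f := evalMod (k + 1) [Nat.pow 2 b, y] ts / 2
    let y' := lowBits k (Nat.add y (Nat.mul f (Nat.sub (Nat.pow 2 k) d)))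
    let f' := evalMod (k + 1) [Nat.pow 2 b, y'] (derivTerms ts) / 2
    (y', lowBits k (Nat.mul d (Nat.sub (Nat.add (Nat.pow 2 (k + k)) 2) (lowBits k (Nat.mul f' d)))))

/-- An approximate root `y` of `ts` in the `2`-adic integers with the first variable set to `2 ^ b`,
computed by Newton iteration with increasing precisions `ks`. -/
def newton (b : ℕ) (ts : List (ℤ × List ℕ)) (y : ℕ) (ks : List ℕ) : ℕ :=
  (ks.foldl (fun yd k => newtonStep b ts k yd)
    (y, evalMod b [Nat.pow 2 b, y] (derivTerms ts) / 2)).1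

/-- The sum of `(α (i + t) * n_t + β (i + t)) * 2 ^ (b * t)` over the `2 ^ k` base `2 ^ b` digits
`n_t` of `n`. -/
def tree (b : ℕ) (α β : ℕ → ℕ) : ℕ → ℕ → ℕ → ℕ
  | 0, i, n => Nat.add (Nat.mul (α i) n) (β i)
  | k + 1, i, n =>
    Nat.add (tree b α β k i (lowBits (b * 2 ^ k) n))
      (Nat.mul (tree b α β k (i + 2 ^ k) (Nat.shiftRight n (b * 2 ^ k)))
        (Nat.pow 2 (b * 2 ^ k)))

/-- The sum of `|n_t - h| * 9 ^ (2 ^ k - 1 - t)` over the `2 ^ k` base `2 ^ b` digits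
`n_t` of `n`. -/
def treeNorm (b h : ℕ) : ℕ → ℕ → ℕ
  | 0, n => Nat.add (Nat.sub n h) (Nat.sub h n)
  | k + 1, n =>
    Nat.add (Nat.mul (treeNorm b h k (lowBits (b * 2 ^ k) n)) (Nat.pow 9 (2 ^ k)))
      (treeNorm b h k (Nat.shiftRight n (b * 2 ^ k)))

def balance (b h d v : ℕ) : ℕ :=
  lowBits (b * 2 ^ d) (Nat.add v (tree b (fun _ => 0) (fun _ => h) d 0 0))

def treeVal (b h d : ℕ) (c : ℕ → ℤ) (n : ℕ) : ℕ :=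
  lowBits (b * 2 ^ d) (Nat.add
    (tree b (fun i => (c i).toNat) (fun i => Nat.mul (-c i).toNat h) d 0 n)
    (Nat.sub (Nat.pow 2 (b * 2 ^ d)) (lowBits (b * 2 ^ d)
      (tree b (fun i => (-c i).toNat) (fun i => Nat.mul (c i).toNat h) d 0 n))))

def charSum (j i : ℕ) : ℤ :=
  if (i + 9 * j) % 10 = 5 then 6 else if (i + 9 * j) % 2 = 1 then -4 else 0

def oddPart (j i : ℕ) : ℤ := if (i + 9 * j) % 2 = 1 then 2 else 0

def balancedPow (b h d y j : ℕ) : ℕ := balance b h d (powMod (b * 2 ^ d) y j)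

def signedSum (b h d y u j : ℕ) : ℕ :=
  lowBits (b * 2 ^ d) (Nat.add (treeVal b h d (charSum j) (balancedPow b h d y j))
    (treeVal b h d (oddPart j) (balancedPow b h d u j)))

def hexTerms : List (ℤ × List ℕ) :=
  [(-1170237128555888640000, [10, 0, 0, 0, 0, 0, 0]), (382464000, [0, 0, 0, 0, 1, 0, 1]),
    (23679461376, [1, 0, 0, 0, 1, 1, 0]), (648644060160, [2, 0, 0, 0, 2, 0, 0]),
    (28965073413120, [3, 0, 0, 1, 1, 0, 0]), (682771880038400, [4, 0, 0, 2, 0, 0, 0]),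
    (-1251125376000, [2, 0, 1, 0, 0, 0, 1]), (-58448250740736, [3, 0, 1, 0, 0, 1, 0]),
    (-292835756390400, [4, 0, 1, 0, 1, 0, 0]), (18515287147161600, [5, 0, 1, 1, 0, 0, 0]),
    (129753967697280000, [6, 0, 2, 0, 0, 0, 0]), (30304480, [0, 0, 2, 2, 0, 0, 0]),
    (2412883200, [1, 0, 3, 1, 0, 0, 0]), (5439125760, [2, 0, 4, 0, 0, 0, 0]),
    (-169513451520, [3, 1, 0, 0, 0, 0, 1]), (764637670425600, [5, 1, 0, 0, 1, 0, 0]),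
    (24956859135590400, [6, 1, 0, 1, 0, 0, 0]), (123511232, [0, 1, 0, 3, 0, 0, 0]),
    (529102168738560000, [7, 1, 1, 0, 0, 0, 0]), (-1438668000, [0, 1, 1, 1, 1, 0, 0]),
    (-37245953600, [1, 1, 1, 2, 0, 0, 0]), (-1580352336, [0, 1, 2, 0, 0, 1, 0]),
    (-104382860400, [1, 1, 2, 0, 1, 0, 0]), (-2198361139680, [2, 1, 2, 1, 0, 0, 0]),
    (-14212515995040, [3, 1, 3, 0, 0, 0, 0]), (4172426437234176000, [8, 2, 0, 0, 0, 0, 0]),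
    (-133235856, [0, 2, 0, 0, 2, 0, 0]), (677204544, [0, 2, 0, 1, 0, 1, 0]),
    (-398048462400, [2, 2, 0, 2, 0, 0, 0]), (-729364512, [0, 2, 1, 0, 0, 0, 1]),
    (-46386580032, [1, 2, 1, 0, 0, 1, 0]), (-1663005643200, [2, 2, 1, 0, 1, 0, 0]),
    (-35930067210240, [3, 2, 1, 1, 0, 0, 0]), (-385849773003600, [4, 2, 2, 0, 0, 0, 0]),
    (-65607288, [0, 2, 4, 0, 0, 0, 0]), (-3580895040, [1, 3, 0, 0, 0, 0, 1]),
    (49506128640, [2, 3, 0, 0, 0, 1, 0]), (6509003698560, [3, 3, 0, 0, 1, 0, 0]),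
    (19604698160000, [4, 3, 0, 1, 0, 0, 0]), (-3925020392971200, [5, 3, 1, 0, 0, 0, 0]),
    (141631780, [0, 3, 2, 1, 0, 0, 0]), (1177190580, [1, 3, 3, 0, 0, 0, 0]),
    (-17279199917313600, [6, 4, 0, 0, 0, 0, 0]), (15483152, [0, 4, 0, 2, 0, 0, 0]),
    (9102004960, [1, 4, 1, 1, 0, 0, 0]), (231113974980, [2, 4, 2, 0, 0, 0, 0]),
    (-32361852, [0, 5, 0, 0, 0, 1, 0]), (-711513756, [1, 5, 0, 0, 1, 0, 0]),
    (116949180600, [2, 5, 0, 1, 0, 0, 0]), (4191630679896, [3, 5, 1, 0, 0, 0, 0]),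
    (11935951754900, [4, 6, 0, 0, 0, 0, 0]), (1266571, [0, 6, 2, 0, 0, 0, 0]),
    (-516091, [0, 7, 0, 1, 0, 0, 0]), (82097617, [1, 7, 1, 0, 0, 0, 0]),
    (1309470735, [2, 8, 0, 0, 0, 0, 0])]

def evalTerms {R : Type*} [CommRing R] (x : List R) (ts : List (ℤ × List ℕ)) : R :=
  (ts.map fun t => (t.1 : R) * (List.zipWith (· ^ ·) x t.2).prod).sum

theorem map_evalTerms {R S : Type*} [CommRing R] [CommRing S] (f : R →+* S) (x : List R)
    (ts : List (ℤ × List ℕ)) : f (evalTerms x ts) = evalTerms (x.map f) ts := by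
  have h : ∀ (x : List R) (e : List ℕ), f (List.zipWith (· ^ ·) x e).prod =
      (List.zipWith (· ^ ·) (x.map f) e).prod := by
    intro x
    induction x with
    | nil => intro e; simp
    | cons a x ih => intro e; cases e <;> simp [ih]
  induction ts with
  | nil => simp [evalTerms]
  | cons t ts ih => simpa [evalTerms, h] using ih

theorem lowBits_eq (k n : ℕ) : lowBits k n = n % 2 ^ k :=
  Nat.and_two_pow_sub_one_eq_mod n k

theorem cast_lowBits (k n : ℕ) : ((lowBits k n : ℕ) : ZMod (2 ^ k)) = n := by
  rw [lowBits_eq, ZMod.natCast_mod]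

theorem cast_powMod (k x e : ℕ) : ((powMod k x e : ℕ) : ZMod (2 ^ k)) = (x : ZMod (2 ^ k)) ^ e := by
  induction e with
  | zero => simp [powMod]
  | succ e ih => simp [powMod, cast_lowBits, ih, pow_succ']

theorem termMod_le (k : ℕ) (x e : List ℕ) : termMod k x e ≤ 2 ^ k := by
  unfold termMod
  split
  · rw [lowBits_eq]; exact (Nat.mod_lt _ (by positivity)).le
  · exact Nat.one_le_two_pow

theorem cast_termMod (k : ℕ) (x e : List ℕ) : ((termMod k x e : ℕ) : ZMod (2 ^ k)) =
    (List.zipWith (· ^ ·) (x.map ((↑) : ℕ → ZMod (2 ^ k))) e).prod := by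
  induction x generalizing e with
  | nil => simp [termMod]
  | cons a x ih => cases e <;> simp [termMod, cast_lowBits, cast_powMod, ih]

theorem cast_two_pow_sub (k t : ℕ) (h : t ≤ 2 ^ k) :
    ((2 ^ k - t : ℕ) : ZMod (2 ^ k)) = -t := by
  rw [Nat.cast_sub h, ZMod.natCast_self, zero_sub]

theorem cast_scaleMod (k t : ℕ) (c : ℤ) (h : t ≤ 2 ^ k) :
    ((scaleMod k t c : ℕ) : ZMod (2 ^ k)) = c * t := by
  cases c with
  | ofNat a => simp [scaleMod]
  | negSucc a =>
    have := cast_two_pow_sub k t h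
    simp only [scaleMod, Nat.mul_eq, Nat.pow_eq, Nat.sub_eq, Nat.cast_mul, this, Int.cast_negSucc]
    push_cast
    ring

theorem cast_evalMod (k : ℕ) (x : List ℕ) (ts : List (ℤ × List ℕ)) :
    ((evalMod k x ts : ℕ) : ZMod (2 ^ k)) = evalTerms (x.map ((↑) : ℕ → ZMod (2 ^ k))) ts := by
  induction ts with
  | nil => simp [evalMod, evalTerms]
  | cons t ts ih =>
    obtain ⟨c, e⟩ := t
    simp only [evalMod, cast_lowBits, Nat.add_eq, Nat.cast_add, ih,
      cast_scaleMod _ _ _ (termMod_le _ _ _), cast_termMod]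
    simp [evalTerms]

/-- `f` is dominated by a polynomial `g` over `ℕ` with `g (1/9) ≤ c`. -/
def Majorized (f : ℤ[X]) (c : ℕ) : Prop :=
  ∃ g : ℕ[X], (∀ i, (f.coeff i).natAbs ≤ g.coeff i) ∧
    g.eval₂ (Nat.castRingHom ℚ) (1 / 9) ≤ c

theorem eval_nonneg (g : ℕ[X]) : 0 ≤ g.eval₂ (Nat.castRingHom ℚ) (1 / 9) := by
  rw [eval₂_eq_sum_range]
  exact Finset.sum_nonneg fun i _ => by simp only [eq_natCast]; positivity

theorem Majorized.add {f f' : ℤ[X]} {c c' : ℕ} (h : Majorized f c) (h' : Majorized f' c') :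
    Majorized (f + f') (c + c') := by
  obtain ⟨g, hg, h⟩ := h
  obtain ⟨g', hg', h'⟩ := h'
  refine ⟨g + g', fun i => ?_, ?_⟩
  · rw [coeff_add, coeff_add]
    exact (Int.natAbs_add_le _ _).trans (add_le_add (hg i) (hg' i))
  · rw [eval₂_add]; push_cast; exact add_le_add h h'

theorem Majorized.mul {f f' : ℤ[X]} {c c' : ℕ} (h : Majorized f c) (h' : Majorized f' c') :
    Majorized (f * f') (c * c') := by
  obtain ⟨g, hg, h⟩ := h
  obtain ⟨g', hg', h'⟩ := h'
  refine ⟨g * g', fun i => ?_, ?_⟩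
  · rw [coeff_mul, coeff_mul]
    refine (Int.natAbs_sum_le _ _).trans (Finset.sum_le_sum fun x _ => ?_)
    rw [Int.natAbs_mul]
    exact Nat.mul_le_mul (hg _) (hg' _)
  · rw [eval₂_mul]; push_cast
    exact mul_le_mul h h' (eval_nonneg _) (by positivity)

theorem Majorized.neg {f : ℤ[X]} {c : ℕ} (h : Majorized f c) : Majorized (-f) c := by
  obtain ⟨g, hg, h⟩ := h
  exact ⟨g, fun i => by simpa using hg i, h⟩

theorem Majorized.intCast (a : ℤ) : Majorized (a : ℤ[X]) a.natAbs := by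
  refine ⟨C a.natAbs, fun i => ?_, by simp⟩
  rw [← eq_intCast C a, coeff_C, coeff_C]
  split <;> simp

theorem Majorized.X : Majorized X 1 := by
  refine ⟨Polynomial.X, fun i => ?_, by rw [eval₂_X]; norm_num⟩
  rw [coeff_X, coeff_X]
  split <;> simp

theorem Majorized.pow {f : ℤ[X]} {c : ℕ} (h : Majorized f c) (n : ℕ) :
    Majorized (f ^ n) (c ^ n) := by
  induction n with
  | zero => simpa using Majorized.intCast 1
  | succ n ih => rw [pow_succ, pow_succ]; exact ih.mul h

/-- Upper bound for `evalTerms`, given upper bounds of the variables. -/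
def boundTerms (x : List ℕ) (ts : List (ℤ × List ℕ)) : ℕ :=
  (ts.map fun t => t.1.natAbs * (List.zipWith (· ^ ·) x t.2).prod).sum

theorem Majorized.evalTerms {x : List ℤ[X]} {c : List ℕ} (h : List.Forall₂ Majorized x c)
    (ts : List (ℤ × List ℕ)) : Majorized (evalTerms x ts) (boundTerms c ts) := by
  have key : ∀ e : List ℕ, Majorized (List.zipWith (· ^ ·) x e).prod
      (List.zipWith (· ^ ·) c e).prod := by
    induction h with
    | nil => intro e; simpa using Majorized.intCast 1
    | cons h _ ih =>
      intro e
      cases e with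
      | nil => simpa using Majorized.intCast 1
      | cons e es => simpa using (h.pow e).mul (ih es)
  induction ts with
  | nil => simpa [FB.evalTerms, boundTerms] using Majorized.intCast 0
  | cons t ts ih =>
    have := ((Majorized.intCast t.1).mul (key t.2)).add ih
    simpa [FB.evalTerms, boundTerms] using this

theorem Majorized.natAbs_coeff_le {f : ℤ[X]} {c : ℕ} (h : Majorized f c) (i : ℕ) :
    (f.coeff i).natAbs ≤ c * 9 ^ i := by
  obtain ⟨g, hg, h⟩ := h
  have h1 : (g.coeff i : ℚ) * (1 / 9) ^ i ≤ g.eval₂ (Nat.castRingHom ℚ) (1 / 9) := by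
    by_cases hi : i ∈ Finset.range (g.natDegree + 1)
    · rw [eval₂_eq_sum_range]
      exact Finset.single_le_sum (f := fun j => (Nat.castRingHom ℚ) (g.coeff j) * (1 / 9) ^ j)
        (fun j _ => by simp only [eq_natCast]; positivity) hi
    · rw [coeff_eq_zero_of_natDegree_lt (by simpa using hi)]
      simpa using eval_nonneg g
  have h2 : (g.coeff i : ℚ) ≤ c * 9 ^ i := by
    have := mul_le_mul_of_nonneg_right (h1.trans h) (show (0 : ℚ) ≤ 9 ^ i by positivity)
    rwa [mul_assoc, ← mul_pow, show (1 / 9 * 9 : ℚ) = 1 by norm_num, one_pow, mul_one] at this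
  exact (hg i).trans (by exact_mod_cast h2)

theorem X_pow_dvd_of_eval_dvd {W : ℤ} (hW : 0 < W) (n : ℕ) (f : ℤ[X])
    (hf : ∀ i < n, |f.coeff i| < W) (h : W ^ n ∣ f.eval W) : X ^ n ∣ f := by
  induction n generalizing f with
  | zero => simp
  | succ n ih =>
    have h0 : f.coeff 0 = 0 := by
      refine Int.eq_zero_of_abs_lt_dvd ?_ (hf 0 (by omega))
      have h1 : W ∣ f.eval W := (dvd_pow_self W (by omega)).trans h
      have h2 : f.eval W = f.divX.eval W * W + f.coeff 0 := by
        conv_lhs => rw [← divX_mul_X_add f]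
        simp
      rw [h2] at h1
      exact (Int.dvd_add_right (Dvd.intro_left _ rfl)).1 h1
    have hfX : f = f.divX * X := by
      conv_lhs => rw [← divX_mul_X_add f, h0]
      simp
    have := ih f.divX (fun i hi => by rw [coeff_divX]; exact hf _ (by omega)) (by
      rw [hfX, eval_mul, eval_X, pow_succ] at h
      exact Int.dvd_of_mul_dvd_mul_right hW.ne' h)
    rw [hfX, pow_succ]
    exact mul_dvd_mul_right this X

/-- Evaluation at `2 ^ b`, modulo `2 ^ k`. -/
def evalBase (b k : ℕ) : ℤ[X] →+* ZMod (2 ^ k) := eval₂RingHom (Int.castRingHom _) (2 ^ b)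

theorem evalBase_eq (b k : ℕ) (f : ℤ[X]) : evalBase b k f = (f.eval (2 ^ b) : ℤ) := by
  rw [evalBase, coe_eval₂RingHom, eval₂_eq_sum_range, eval_eq_sum_range]
  simp

theorem X_pow_dvd_of_evalBase {b m : ℕ} {f : ℤ[X]} {c : ℕ} (h : Majorized f c)
    (hc : c * 9 ^ (m - 1) < 2 ^ b) (h0 : evalBase b (b * m) f = 0) : X ^ m ∣ f := by
  refine X_pow_dvd_of_eval_dvd (W := 2 ^ b) (by positivity) m f (fun i hi => ?_) ?_
  · rw [Int.abs_eq_natAbs]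
    have := ((h.natAbs_coeff_le i).trans (Nat.mul_le_mul_left c
      (Nat.pow_le_pow_right (show 9 > 0 by norm_num) (show i ≤ m - 1 by omega)))).trans_lt hc
    exact_mod_cast this
  · rw [evalBase_eq, ZMod.intCast_zmod_eq_zero_iff_dvd] at h0
    rw [← pow_mul]
    exact_mod_cast h0

/-- The `t`-th digit of `n` in base `2 ^ b`. -/
def digit (b n t : ℕ) : ℕ := n / 2 ^ (b * t) % 2 ^ b

theorem digit_lowBits (b n : ℕ) {t m : ℕ} (h : t < m) :
    digit b (lowBits (b * m) n) t = digit b n t := by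
  rw [lowBits_eq, digit, digit, ← Nat.add_sub_of_le h.le, mul_add, pow_add,
    Nat.mod_mul_right_div_self]
  refine Nat.mod_mod_of_dvd _ (pow_dvd_pow _ ?_)
  exact Nat.le_mul_of_pos_right _ (by omega)

theorem digit_shiftRight (b n t m : ℕ) :
    digit b (Nat.shiftRight n (b * m)) t = digit b n (m + t) := by
  rw [digit, digit, mul_add, pow_add, ← Nat.div_div_eq_div_mul]
  have : Nat.shiftRight n (b * m) = n / 2 ^ (b * m) := Nat.shiftRight_eq_div_pow n _
  rw [this]

theorem lowBits_lt (k n : ℕ) : lowBits k n < 2 ^ k := by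
  rw [lowBits_eq]; exact Nat.mod_lt _ (by positivity)

theorem shiftRight_lt {b n m : ℕ} (h : n < 2 ^ (b * (m + m))) :
    Nat.shiftRight n (b * m) < 2 ^ (b * m) := by
  refine (Nat.shiftRight_eq_div_pow n _).trans_lt (Nat.div_lt_of_lt_mul ?_)
  rwa [← pow_add, ← mul_add]

theorem tree_eq (b : ℕ) (α β : ℕ → ℕ) (k i n : ℕ) (hn : n < 2 ^ (b * 2 ^ k)) :
    tree b α β k i n =
      ∑ t ∈ Finset.range (2 ^ k), (α (i + t) * digit b n t + β (i + t)) * 2 ^ (b * t) := by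
  induction k generalizing i n with
  | zero =>
    have : n % 2 ^ b = n := Nat.mod_eq_of_lt (by simpa using hn)
    simp [tree, digit, this]
  | succ k ih =>
    rw [pow_succ 2 k, mul_two] at hn
    rw [tree, ih _ _ (lowBits_lt _ _), ih _ _ (shiftRight_lt hn),
      pow_succ 2 k, mul_two, Finset.sum_range_add]
    simp only [Nat.add_eq, Nat.mul_eq, Nat.pow_eq, Finset.sum_mul]
    congr 1
    · exact Finset.sum_congr rfl fun t ht => by rw [digit_lowBits _ _ (Finset.mem_range.1 ht)]
    · refine Finset.sum_congr rfl fun t _ => ?_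
      rw [digit_shiftRight, mul_add, pow_add, add_assoc]
      ring

theorem treeNorm_eq (b h k n : ℕ) (hn : n < 2 ^ (b * 2 ^ k)) :
    treeNorm b h k n =
      ∑ t ∈ Finset.range (2 ^ k), ((digit b n t : ℤ) - h).natAbs * 9 ^ (2 ^ k - 1 - t) := by
  induction k generalizing n with
  | zero =>
    have : n % 2 ^ b = n := Nat.mod_eq_of_lt (by simpa using hn)
    simp only [treeNorm, pow_zero, Finset.sum_range_one, digit, mul_zero, this, Nat.div_one,
      Nat.add_eq, Nat.sub_eq]
    omega
  | succ k ih =>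
    rw [pow_succ 2 k, mul_two] at hn
    rw [treeNorm, ih _ (lowBits_lt _ _), ih _ (shiftRight_lt hn),
      pow_succ 2 k, mul_two, Finset.sum_range_add]
    simp only [Nat.add_eq, Nat.mul_eq, Nat.pow_eq, Finset.sum_mul]
    congr 1
    · refine Finset.sum_congr rfl fun t ht => ?_
      rw [digit_lowBits _ _ (Finset.mem_range.1 ht), mul_assoc, ← pow_add]
      congr 2
      have := Finset.mem_range.1 ht
      omega
    · refine Finset.sum_congr rfl fun t ht => ?_
      rw [digit_shiftRight]
      congr 2
      omega

/-- The polynomial whose coefficients are the digits of `n` shifted by `h` and weighted by `c`. -/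
noncomputable def weighted (b h m : ℕ) (c : ℕ → ℤ) (n : ℕ) : ℤ[X] :=
  ∑ t ∈ Finset.range m, monomial t (c t * ((digit b n t : ℤ) - h))

theorem coeff_weighted (b h m : ℕ) (c : ℕ → ℤ) (n i : ℕ) :
    (weighted b h m c n).coeff i = if i < m then c i * ((digit b n i : ℤ) - h) else 0 := by
  simp [weighted, finsetSum_coeff, coeff_monomial]

theorem evalBase_weighted (b h m k : ℕ) (c : ℕ → ℤ) (n : ℕ) : evalBase b k (weighted b h m c n) =
    ∑ t ∈ Finset.range m, (c t * (digit b n t - h) * 2 ^ (b * t) : ZMod (2 ^ k)) := by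
  rw [weighted, map_sum]
  refine Finset.sum_congr rfl fun t _ => ?_
  rw [evalBase, coe_eval₂RingHom, eval₂_monomial]
  simp [pow_mul]

theorem cast_treeVal (b h d : ℕ) (c : ℕ → ℤ) {n : ℕ} (hn : n < 2 ^ (b * 2 ^ d)) :
    ((treeVal b h d c n : ℕ) : ZMod (2 ^ (b * 2 ^ d))) =
      evalBase b (b * 2 ^ d) (weighted b h (2 ^ d) c n) := by
  rw [treeVal, cast_lowBits, Nat.add_eq, Nat.cast_add, Nat.sub_eq, Nat.pow_eq,
    cast_two_pow_sub _ _ (lowBits_lt _ _).le, cast_lowBits, tree_eq _ _ _ _ _ _ hn,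
    tree_eq _ _ _ _ _ _ hn, evalBase_weighted, ← sub_eq_add_neg]
  push_cast
  rw [← Finset.sum_sub_distrib]
  refine Finset.sum_congr rfl fun t _ => ?_
  have hc : (c t : ZMod (2 ^ (b * 2 ^ d))) = (c t).toNat - (-c t).toNat := by
    conv_lhs => rw [← Int.toNat_sub_toNat_neg (c t)]
    push_cast
    rfl
  rw [hc, zero_add]
  simp only [Nat.mul_eq]
  push_cast
  ring

theorem evalBase_balance (b h d v : ℕ) : evalBase b (b * 2 ^ d)
    (weighted b h (2 ^ d) (fun _ => 1) (balance b h d v)) = v := by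
  have hn : balance b h d v < 2 ^ (b * 2 ^ d) := lowBits_lt _ _
  have h1 := tree_eq b (fun _ => 1) (fun _ => 0) d 0 _ hn
  have h2 := tree_eq b (fun _ => 0) (fun _ => h) d 0 0 (by positivity)
  have h3 : ∀ k i n, tree b (fun _ => 1) (fun _ => 0) k i n = n := by
    intro k
    induction k with
    | zero => intro i n; simp [tree]
    | succ k ih =>
      intro i n
      have : Nat.shiftRight n (b * 2 ^ k) = n / 2 ^ (b * 2 ^ k) := Nat.shiftRight_eq_div_pow n _
      rw [tree, ih, ih, this, lowBits_eq]
      exact Nat.mod_add_div' _ _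
  have h4 : ((balance b h d v : ℕ) : ZMod (2 ^ (b * 2 ^ d))) =
      v + (tree b (fun _ => 0) (fun _ => h) d 0 0 : ℕ) := by
    rw [balance, cast_lowBits, Nat.add_eq, Nat.cast_add]
  rw [h3] at h1
  have h5 := congrArg ((↑) : ℕ → ZMod (2 ^ (b * 2 ^ d))) h1
  rw [evalBase_weighted, eq_sub_of_add_eq h4.symm, h5, h2]
  push_cast
  rw [← Finset.sum_sub_distrib]
  exact Finset.sum_congr rfl fun t _ => by ring

theorem majorized_decoded {b h d n c : ℕ} (hn : n < 2 ^ (b * 2 ^ d))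
    (hc : treeNorm b h d n ≤ c * 9 ^ (2 ^ d - 1)) :
    Majorized (weighted b h (2 ^ d) (fun _ => 1) n) c := by
  rw [treeNorm_eq b h d n hn] at hc
  refine ⟨∑ t ∈ Finset.range (2 ^ d), monomial t ((digit b n t : ℤ) - h).natAbs, fun i => ?_, ?_⟩
  · simp only [weighted, finsetSum_coeff, coeff_monomial, Finset.sum_ite_eq']
    split <;> simp
  · have h' : ((∑ t ∈ Finset.range (2 ^ d),
        ((digit b n t : ℤ) - h).natAbs * 9 ^ (2 ^ d - 1 - t) : ℕ) : ℚ) ≤ c * 9 ^ (2 ^ d - 1) := by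
      exact_mod_cast hc
    rw [eval₂_finsetSum]
    refine le_of_mul_le_mul_right (le_trans (le_of_eq ?_) h') (by positivity)
    rw [Finset.sum_mul, Nat.cast_sum]
    refine Finset.sum_congr rfl fun t ht => ?_
    rw [eval₂_monomial]
    have ht := Finset.mem_range.1 ht
    have : (9 : ℚ) ^ (2 ^ d - 1) = 9 ^ t * 9 ^ (2 ^ d - 1 - t) := by
      rw [← pow_add]; congr 1; omega
    rw [this, one_div, inv_pow]
    simp only [eq_natCast]
    push_cast
    field_simp

theorem Majorized.weighted {b h d n c e : ℕ} (w : ℕ → ℤ) (hw : ∀ i, (w i).natAbs ≤ e)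
    (hn : n < 2 ^ (b * 2 ^ d)) (hc : treeNorm b h d n ≤ c * 9 ^ (2 ^ d - 1)) :
    Majorized (weighted b h (2 ^ d) w n) (e * c) := by
  obtain ⟨g, hg, hg'⟩ := majorized_decoded hn hc
  refine ⟨e • g, fun i => ?_, ?_⟩
  · have := hg i
    rw [coeff_smul, smul_eq_mul]
    rw [coeff_weighted] at this ⊢
    split
    · rw [if_pos ‹_›, one_mul] at this
      rw [Int.natAbs_mul]
      exact Nat.mul_le_mul (hw i) this
    · simp
  · rw [nsmul_eq_mul, eval₂_mul, eval₂_natCast]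
    push_cast
    exact mul_le_mul_of_nonneg_left hg' (by positivity)

theorem coeff_eq_of_X_pow_dvd_sub {R : Type*} [CommRing R] {f g : R[X]} {m i : ℕ}
    (h : X ^ m ∣ f - g) (hi : i < m) : f.coeff i = g.coeff i := by
  have := X_pow_dvd_iff.1 h i hi
  rwa [coeff_sub, sub_eq_zero] at this

theorem X_pow_dvd_decoded_sub_pow {b h d y j c e : ℕ} {Y : ℤ[X]}
    (hc : treeNorm b h d (balancedPow b h d y j) ≤ c * 9 ^ (2 ^ d - 1))
    (hY : Majorized Y e) (hYy : evalBase b (b * 2 ^ d) Y = y)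
    (hb : (c + e ^ j) * 9 ^ (2 ^ d - 1) < 2 ^ b) :
    X ^ 2 ^ d ∣ weighted b h (2 ^ d) (fun _ => 1) (balancedPow b h d y j) - Y ^ j := by
  have h1 := majorized_decoded (lowBits_lt _ _) hc
  refine X_pow_dvd_of_evalBase ?_ hb ?_
  · rw [sub_eq_add_neg]
    exact h1.add (hY.pow j).neg
  · rw [map_sub, map_pow, hYy, balancedPow, evalBase_balance, cast_powMod, sub_self]

theorem charSum_natAbs_le (j i : ℕ) : (charSum j i).natAbs ≤ 6 := by
  unfold charSum; split_ifs <;> decide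

theorem oddPart_natAbs_le (j i : ℕ) : (oddPart j i).natAbs ≤ 2 := by
  unfold oddPart; split_ifs <;> decide

theorem evalBase_evalTerms (b k : ℕ) (x : List ℤ[X]) (n : List ℕ)
    (h : List.Forall₂ (fun f (a : ℕ) => evalBase b k f = a) x n) (ts : List (ℤ × List ℕ))
    (h0 : evalMod k n ts = 0) : evalBase b k (evalTerms x ts) = 0 := by
  have : x.map (evalBase b k) = n.map ((↑) : ℕ → ZMod (2 ^ k)) := by
    clear h0
    induction h with
    | nil => rfl
    | cons h _ ih => simp [h, ih]
  rw [map_evalTerms, this, ← cast_evalMod, h0, Nat.cast_zero]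

/-- The numerical facts about approximations `y`, `z` of the roots of `fStar`, `gStar`, and
`u = (2 ^ b) ^ 6 * z`, from which the existence of polynomials approximating the roots follows. -/
def Checks (b h d y z u : ℕ) : Prop :=
  evalMod (b * 2 ^ d) [2 ^ b, y] fStar = 0 ∧
  evalMod (b * 2 ^ d) [2 ^ b, z] gStar = 0 ∧
  digit b (balance b h d y) 0 = h + 1 ∧
  digit b (balance b h d z) 0 = h + 18225 ∧
  treeNorm b h d (balance b h d y) ≤ 4 * 9 ^ (2 ^ d - 1) ∧
  treeNorm b h d (balance b h d z) ≤ 36000 * 9 ^ (2 ^ d - 1) ∧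
  (∀ j < 7, treeNorm b h d (balancedPow b h d y j) ≤ 4 ^ j * 9 ^ (2 ^ d - 1)) ∧
  (∀ j < 7, treeNorm b h d (balancedPow b h d u j) ≤ 1 * 9 ^ (2 ^ d - 1)) ∧
  evalMod (b * 2 ^ d) [2 ^ b, signedSum b h d y u 1, signedSum b h d y u 2,
    signedSum b h d y u 3, signedSum b h d y u 4, signedSum b h d y u 5,
    signedSum b h d y u 6] hexTerms = 0 ∧
  boundTerms [1, 4] fStar * 9 ^ (2 ^ d - 1) < 2 ^ b ∧
  boundTerms [1, 36000] gStar * 9 ^ (2 ^ d - 1) < 2 ^ b ∧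
  (∀ j < 7, (4 ^ j + 4 ^ j) * 9 ^ (2 ^ d - 1) < 2 ^ b) ∧
  (∀ j < 7, (1 + (1 ^ 6 * 36000) ^ j) * 9 ^ (2 ^ d - 1) < 2 ^ b) ∧
  boundTerms [1, 6 * 4 ^ 1 + 2 * 1, 6 * 4 ^ 2 + 2 * 1, 6 * 4 ^ 3 + 2 * 1,
    6 * 4 ^ 4 + 2 * 1, 6 * 4 ^ 5 + 2 * 1, 6 * 4 ^ 6 + 2 * 1] hexTerms *
      9 ^ (2 ^ d - 1) < 2 ^ b

instance (b h d y z u : ℕ) : Decidable (Checks b h d y z u) := by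
  unfold Checks; infer_instance

theorem exists_approx_of_checks (b h d y z u : ℕ) (hu : u = lowBits (b * 2 ^ d) ((2 ^ b) ^ 6 * z))
    (hc : Checks b h d y z u) :
    ∃ (Y Z : ℤ[X]) (S : ℕ → ℤ[X]), Y.coeff 0 = 1 ∧ Z.coeff 0 = 18225 ∧
      X ^ 2 ^ d ∣ evalTerms [X, Y] fStar ∧ X ^ 2 ^ d ∣ evalTerms [X, Z] gStar ∧
      (∀ j < 7, ∀ n < 2 ^ d, (S j).coeff n =
        charSum j n * (Y ^ j).coeff n + oddPart j n * ((X ^ 6 * Z) ^ j).coeff n) ∧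
      X ^ 2 ^ d ∣ evalTerms [X, S 1, S 2, S 3, S 4, S 5, S 6] hexTerms := by
  obtain ⟨hY, hZ, hY0, hZ0, nY, nZ, nYp, nUp, hS, bY, bZ, bYp, bUp, bS⟩ := hc
  have hX : evalBase b (b * 2 ^ d) X = ((2 ^ b : ℕ) : ZMod (2 ^ (b * 2 ^ d))) := by
    simp [evalBase]
  set Y := weighted b h (2 ^ d) (fun _ => 1) (balance b h d y) with hYdef
  set Z := weighted b h (2 ^ d) (fun _ => 1) (balance b h d z) with hZdef
  have hYy : evalBase b (b * 2 ^ d) Y = y := evalBase_balance _ _ _ _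
  have hZz : evalBase b (b * 2 ^ d) Z = z := evalBase_balance _ _ _ _
  have mY : Majorized Y 4 := majorized_decoded (lowBits_lt _ _) nY
  have mZ : Majorized Z 36000 := majorized_decoded (lowBits_lt _ _) nZ
  have hUu : evalBase b (b * 2 ^ d) (X ^ 6 * Z) = u := by
    rw [map_mul, map_pow, hX, hZz, hu, cast_lowBits]; push_cast; rfl
  set S : ℕ → ℤ[X] := fun j => weighted b h (2 ^ d) (charSum j) (balancedPow b h d y j) +
    weighted b h (2 ^ d) (oddPart j) (balancedPow b h d u j) with hSdef
  have hSs : ∀ j, evalBase b (b * 2 ^ d) (S j) = signedSum b h d y u j := fun j => by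
    rw [hSdef, map_add, signedSum, cast_lowBits, Nat.add_eq, Nat.cast_add,
      cast_treeVal b h d (charSum j) (n := balancedPow b h d y j) (lowBits_lt _ _),
      cast_treeVal b h d (oddPart j) (n := balancedPow b h d u j) (lowBits_lt _ _)]
  have mS : ∀ j < 7, Majorized (S j) (6 * 4 ^ j + 2 * 1) := fun j hj =>
    (Majorized.weighted _ (charSum_natAbs_le j) (lowBits_lt _ _) (nYp j hj)).add
      (Majorized.weighted _ (oddPart_natAbs_le j) (lowBits_lt _ _) (nUp j hj))
  have hpos : 0 < 2 ^ d := by positivity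
  refine ⟨Y, Z, S, ?_, ?_, ?_, ?_, fun j hj n hn => ?_, ?_⟩
  · rw [hYdef, coeff_weighted, if_pos hpos, hY0]; push_cast; ring
  · rw [hZdef, coeff_weighted, if_pos hpos, hZ0]; push_cast; ring
  · exact X_pow_dvd_of_evalBase (Majorized.evalTerms (.cons .X (.cons mY .nil)) _) bY
      (evalBase_evalTerms _ _ _ _ (.cons hX (.cons hYy .nil)) _ hY)
  · exact X_pow_dvd_of_evalBase (Majorized.evalTerms (.cons .X (.cons mZ .nil)) _) bZ
      (evalBase_evalTerms _ _ _ _ (.cons hX (.cons hZz .nil)) _ hZ)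
  · rw [← coeff_eq_of_X_pow_dvd_sub (X_pow_dvd_decoded_sub_pow (nYp j hj) mY hYy (bYp j hj)) hn,
      ← coeff_eq_of_X_pow_dvd_sub (X_pow_dvd_decoded_sub_pow (nUp j hj)
        ((Majorized.X.pow 6).mul mZ) hUu (bUp j hj)) hn]
    simp [hSdef, coeff_weighted, hn]
  · refine X_pow_dvd_of_evalBase (Majorized.evalTerms (.cons .X (.cons (mS 1 ?_) (.cons (mS 2 ?_)
      (.cons (mS 3 ?_) (.cons (mS 4 ?_) (.cons (mS 5 ?_) (.cons (mS 6 ?_) .nil))))))) _) bS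
      (evalBase_evalTerms _ _ _ _ (.cons hX (.cons (hSs 1) (.cons (hSs 2) (.cons (hSs 3)
        (.cons (hSs 4) (.cons (hSs 5) (.cons (hSs 6) .nil))))))) _ hS) <;> norm_num

/-- Base `2 ^ 3456` approximation of the root of `fStar` with constant coefficient `1`. -/
def rootY : ℕ :=
  newton 3456 fStar 1 (List.replicate 12 3456 ++ (List.range 11).map (fun i => 3458 * 2 ^ i) ++
    [3458 * 1024])

/-- Base `2 ^ 3456` approximation of the root of `gStar` with constant coefficient `18225`. -/
def rootZ : ℕ :=
  newton 3456 gStar 18225 (List.replicate 12 3456 ++ (List.range 11).map (fun i => 3458 * 2 ^ i) ++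
    [3458 * 1024])

def rootU : ℕ := lowBits (3456 * 2 ^ 10) ((2 ^ 3456) ^ 6 * rootZ)

theorem exists_approx : ∃ (Y Z : ℤ[X]) (S : ℕ → ℤ[X]), Y.coeff 0 = 1 ∧ Z.coeff 0 = 18225 ∧
      X ^ 2 ^ 10 ∣ evalTerms [X, Y] fStar ∧ X ^ 2 ^ 10 ∣ evalTerms [X, Z] gStar ∧
      (∀ j < 7, ∀ n < 2 ^ 10, (S j).coeff n =
        charSum j n * (Y ^ j).coeff n + oddPart j n * ((X ^ 6 * Z) ^ j).coeff n) ∧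
      X ^ 2 ^ 10 ∣ evalTerms [X, S 1, S 2, S 3, S 4, S 5, S 6] hexTerms := by
  exact exists_approx_of_checks 3456 (2 ^ 3455) 10 rootY rootZ rootU rfl (by decide +kernel)

section Hensel

variable {k : Type*} [Field k] (G : (PowerSeries k)[X])

theorem constantCoeff_eq_of_X_dvd_sub {f g : PowerSeries k} (h : PowerSeries.X ∣ f - g) :
    PowerSeries.constantCoeff f = PowerSeries.constantCoeff g := by
  rw [PowerSeries.X_dvd_iff, map_sub, sub_eq_zero] at h
  exact h

theorem X_pow_dvd_newton {a : PowerSeries k} {n : ℕ}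
    (ha : PowerSeries.X ^ (n + 1) ∣ G.eval a)
    (hd : PowerSeries.constantCoeff (G.derivative.eval a) ≠ 0) :
    PowerSeries.X ^ (n + 2) ∣ G.eval (a - PowerSeries.C
      (PowerSeries.constantCoeff (G.derivative.eval a))⁻¹ * G.eval a) := by
  obtain ⟨q, hq⟩ := G.binomExpansion a (-(PowerSeries.C
      (PowerSeries.constantCoeff (G.derivative.eval a))⁻¹ * G.eval a))
  rw [sub_eq_add_neg, hq]
  set d := PowerSeries.constantCoeff (G.derivative.eval a)
  have h1 : PowerSeries.X ∣ 1 - PowerSeries.C d⁻¹ * G.derivative.eval a := by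
    rw [PowerSeries.X_dvd_iff, map_sub, map_mul, PowerSeries.constantCoeff_C, map_one]
    exact sub_eq_zero.2 (inv_mul_cancel₀ hd).symm
  have h2 : PowerSeries.X ^ (n + 2) ∣ G.eval a * G.eval a := by
    refine dvd_trans (pow_dvd_pow _ (by omega : n + 2 ≤ (n + 1) + (n + 1))) ?_
    rw [pow_add]
    exact mul_dvd_mul ha ha
  have h3 : PowerSeries.X ^ (n + 2) ∣ G.eval a * (1 - PowerSeries.C d⁻¹ * G.derivative.eval a) :=
    by rw [pow_succ]; exact mul_dvd_mul ha h1
  refine (dvd_add h3 (h2.mul_left (q * PowerSeries.C d⁻¹ ^ 2))).trans (dvd_of_eq ?_)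
  ring

/-- Hensel's lemma for power series. -/
theorem exists_root_of_X_dvd {a : PowerSeries k} (ha : PowerSeries.X ∣ G.eval a)
    (hd : PowerSeries.constantCoeff (G.derivative.eval a) ≠ 0) :
    ∃ z, G.eval z = 0 ∧ PowerSeries.X ∣ z - a := by
  let step : PowerSeries k → PowerSeries k := fun a =>
    a - PowerSeries.C (PowerSeries.constantCoeff (G.derivative.eval a))⁻¹ * G.eval a
  let s : ℕ → PowerSeries k := fun n => step^[n] a
  have hs : ∀ n, s (n + 1) = step (s n) := fun n => Function.iterate_succ_apply' step n a
  have key : ∀ n, PowerSeries.X ^ (n + 1) ∣ G.eval (s n) ∧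
      PowerSeries.constantCoeff (G.derivative.eval (s n)) ≠ 0 := by
    intro n
    induction n with
    | zero => exact ⟨by simpa [s] using ha, hd⟩
    | succ n ih =>
      refine ⟨hs n ▸ X_pow_dvd_newton G ih.1 ih.2, ?_⟩
      have : PowerSeries.X ∣ G.derivative.eval (s (n + 1)) - G.derivative.eval (s n) := by
        refine dvd_trans ?_ (sub_dvd_eval_sub _ _ _)
        rw [hs]
        simp only [step, sub_sub_cancel_left, dvd_neg]
        exact ((dvd_pow_self _ (by omega)).trans ih.1).mul_left _
      rw [constantCoeff_eq_of_X_dvd_sub this]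
      exact ih.2
  have hstep : ∀ n, PowerSeries.X ^ (n + 1) ∣ s (n + 1) - s n := fun n => by
    rw [hs]
    simp only [step, sub_sub_cancel_left, dvd_neg]
    exact (key n).1.mul_left _
  have hmono : ∀ n m, n ≤ m → PowerSeries.X ^ (n + 1) ∣ s m - s n := by
    intro n m h
    induction m, h using Nat.le_induction with
    | base => simp
    | succ m hm ih =>
      have := dvd_add ((pow_dvd_pow _ (by omega : n + 1 ≤ m + 1)).trans (hstep m)) ih
      rwa [sub_add_sub_cancel] at this
  let z : PowerSeries k := PowerSeries.mk fun n => PowerSeries.coeff n (s n)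
  have hz : ∀ n, PowerSeries.X ^ (n + 1) ∣ z - s n := by
    intro n
    rw [PowerSeries.X_pow_dvd_iff]
    intro m hm
    have := PowerSeries.X_pow_dvd_iff.1 (hmono m n (by omega)) m (by omega)
    rw [map_sub] at this ⊢
    rw [PowerSeries.coeff_mk, ← neg_eq_zero, neg_sub, this]
  refine ⟨z, ?_, by simpa [s] using hz 0⟩
  ext n
  have h1 : PowerSeries.X ^ (n + 1) ∣ G.eval z := by
    have := dvd_add ((hz n).trans (sub_dvd_eval_sub z (s n) G)) (key n).1
    rwa [sub_add_cancel] at this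
  exact PowerSeries.X_pow_dvd_iff.1 h1 n (by omega)

theorem X_pow_dvd_root_sub {a z : PowerSeries k} {n : ℕ} (hz : G.eval z = 0)
    (hza : PowerSeries.X ∣ z - a) (ha : PowerSeries.X ^ n ∣ G.eval a)
    (hd : PowerSeries.constantCoeff (G.derivative.eval a) ≠ 0) :
    PowerSeries.X ^ n ∣ z - a := by
  obtain ⟨q, hq⟩ := G.binomExpansion a (z - a)
  rw [add_sub_cancel, hz] at hq
  have hu : IsUnit (G.derivative.eval a + q * (z - a)) := by
    rw [PowerSeries.isUnit_iff_constantCoeff, map_add, map_mul, PowerSeries.X_dvd_iff.1 hza,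
      mul_zero, add_zero]
    exact hd.isUnit
  rw [← hu.dvd_mul_left, show (G.derivative.eval a + q * (z - a)) * (z - a) = -G.eval a by
    linear_combination -hq, dvd_neg]
  exact ha

end Hensel

theorem prod_zipWith_pow_scaled {R : Type*} [CommRing R] (u : R) (wt : List ℕ) (x : List R)
    (e : List ℕ) (h : x.length ≤ wt.length) :
    (List.zipWith (· ^ ·) (List.zipWith (fun k a => u ^ k * a) wt x) e).prod =
      u ^ (List.zipWith (· * ·) wt (List.zipWith (fun _ b => b) x e)).sum *
        (List.zipWith (· ^ ·) x e).prod := by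
  induction x generalizing wt e with
  | nil => simp
  | cons a x ih =>
    cases wt with
    | nil => simp at h
    | cons k wt =>
      cases e with
      | nil => simp
      | cons b e =>
        simp only [List.length_cons, add_le_add_iff_right] at h
        simp only [List.zipWith_cons_cons, List.prod_cons, List.sum_cons, ih wt e h]
        rw [pow_add, mul_pow, ← pow_mul]
        ring

/-- Scaling of the variables of `ts` with weights `wt`. -/
theorem evalTerms_scaled {R : Type*} [CommRing R] (u v : R) (wt : List ℕ) (x : List R)
    (ts : List (ℤ × List ℕ)) (h : x.length ≤ wt.length)
    (hts : ∀ t ∈ ts, u ^ (List.zipWith (· * ·) wt (List.zipWith (fun _ b => b) x t.2)).sum = v) :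
    evalTerms (List.zipWith (fun k a => u ^ k * a) wt x) ts = v * evalTerms x ts := by
  rw [evalTerms, evalTerms, ← List.sum_map_mul_left]
  refine congrArg List.sum (List.map_congr_left fun t ht => ?_)
  rw [prod_zipWith_pow_scaled u wt x t.2 h, hts t ht]
  ring

theorem dvd_evalTerms_sub {R : Type*} [CommRing R] {d : R} {x x' : List R}
    (h : List.Forall₂ (fun a b => d ∣ a - b) x x') (ts : List (ℤ × List ℕ)) :
    d ∣ evalTerms x ts - evalTerms x' ts := by
  rw [← Ideal.mem_span_singleton, ← Ideal.Quotient.eq, map_evalTerms, map_evalTerms]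
  congr 1
  induction h with
  | nil => rfl
  | cons h _ ih =>
    rw [List.map_cons, List.map_cons, ih, Ideal.Quotient.eq.2 (Ideal.mem_span_singleton.2 h)]

/-- Signed power sums. -/
def signedPowerSum {ι R : Type*} [Fintype ι] [DecidableEq ι] [CommRing R] (S : Finset ι)
    (b : ι → R) (j : ℕ) : R :=
  ∑ i, (if i ∈ S then 1 else -1) * b i ^ j

/-- The homogeneous polynomial of degree `10` vanishing on hexads. -/
def hexPoly {ι R : Type*} [Fintype ι] [DecidableEq ι] [CommRing R] (w : R) (S : Finset ι)
    (b : ι → R) : R :=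
  evalTerms [w, signedPowerSum S b 1, signedPowerSum S b 2, signedPowerSum S b 3,
    signedPowerSum S b 4, signedPowerSum S b 5, signedPowerSum S b 6] hexTerms

section HexPoly

variable {ι R R' : Type*} [Fintype ι] [DecidableEq ι] [CommRing R] [CommRing R']

theorem map_signedPowerSum (f : R →+* R') (S : Finset ι) (b : ι → R) (j : ℕ) :
    f (signedPowerSum S b j) = signedPowerSum S (fun i => f (b i)) j := by
  simp only [signedPowerSum, map_sum, map_mul, map_pow]
  refine Finset.sum_congr rfl fun i _ => ?_
  split <;> simp

theorem map_hexPoly (f : R →+* R') (w : R) (S : Finset ι) (b : ι → R) :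
    f (hexPoly w S b) = hexPoly (f w) S fun i => f (b i) := by
  simp only [hexPoly, map_evalTerms, List.map_cons, List.map_nil, map_signedPowerSum]

theorem hexPoly_map (e : ι ≃ ι) (w : R) (S : Finset ι) (b : ι → R) :
    hexPoly w (S.map e.toEmbedding) b = hexPoly w S (fun i => b (e i)) := by
  have : ∀ j, signedPowerSum (S.map e.toEmbedding) b j = signedPowerSum S (fun i => b (e i)) j := by
    intro j
    rw [signedPowerSum, signedPowerSum, ← e.sum_comp]
    simp
  simp only [hexPoly, this]

theorem hexPoly_scaled (u w : R) (S : Finset ι) (b : ι → R) :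
    hexPoly (u * w) S (fun i => u * b i) = u ^ 10 * hexPoly w S b := by
  have h : ∀ j, signedPowerSum S (fun i => u * b i) j = u ^ j * signedPowerSum S b j := by
    intro j
    simp only [signedPowerSum, Finset.mul_sum]
    exact Finset.sum_congr rfl fun i _ => by rw [mul_pow]; ring
  have := evalTerms_scaled u (u ^ 10) [1, 1, 2, 3, 4, 5, 6] [w, signedPowerSum S b 1,
    signedPowerSum S b 2, signedPowerSum S b 3, signedPowerSum S b 4, signedPowerSum S b 5,
    signedPowerSum S b 6] hexTerms (by simp) (by
      have : ∀ t ∈ hexTerms, (List.zipWith (· * ·) [1, 1, 2, 3, 4, 5, 6]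
          (List.zipWith (fun _ b => b) [(), (), (), (), (), (), ()] t.2)).sum = 10 := by decide
      intro t ht
      rw [← this t ht]
      congr 3
      generalize t.2 = l
      rcases l with _ | ⟨a, _ | ⟨b, _ | ⟨c, _ | ⟨d, _ | ⟨e, _ | ⟨f, _ | ⟨g, l⟩⟩⟩⟩⟩⟩⟩ <;> rfl)
  rw [hexPoly, hexPoly, ← this]
  simp only [List.zipWith_cons_cons, List.zipWith_nil_left, h, pow_one]

end HexPoly

/-- The defining polynomial, monic form, in variables `s` and `y`. -/
def fTerms : List (ℤ × List ℕ) :=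
  [(332150625, [0, 0]), (1328602500, [0, 1]), (-319848750, [0, 2]), (1131772500, [0, 3]),
    (100875375, [0, 4]), (-107163000, [0, 5]), (-10570500, [0, 6]), (3645000, [0, 7]),
    (888975, [0, 8]), (83700, [0, 9]), (4050, [0, 10]), (100, [0, 11]), (1, [0, 12]),
    (-1007769600, [1, 2])]

noncomputable def fPoly : ℤ[X][X] := evalTerms [C X, X] fTerms

theorem map_fPoly {R : Type*} [CommRing R] (φ : ℤ[X] →+* R) :
    fPoly.map φ = evalTerms [C (φ X), X] fTerms := by
  rw [← coe_mapRingHom, fPoly, map_evalTerms]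
  simp

theorem eval_map_fPoly {R : Type*} [CommRing R] (φ : ℤ[X] →+* R) (b : R) :
    (fPoly.map φ).eval b = evalTerms [φ X, b] fTerms := by
  rw [map_fPoly, ← coe_evalRingHom, map_evalTerms]
  simp

theorem fPoly_eq : fPoly = X ^ 12 + (100 * X ^ 11 + 4050 * X ^ 10 + 83700 * X ^ 9 +
    888975 * X ^ 8 + 3645000 * X ^ 7 - 10570500 * X ^ 6 - 107163000 * X ^ 5 + 100875375 * X ^ 4
    + 1131772500 * X ^ 3 + C (-319848750 - 1007769600 * X) * X ^ 2 + 1328602500 * X +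
      332150625) := by
  simp only [fPoly, evalTerms, fTerms, List.map_cons, List.map_nil, List.zipWith_cons_cons,
    List.zipWith_nil_left, List.prod_cons, List.prod_nil, List.sum_cons, List.sum_nil]
  push_cast
  simp only [C_sub, C_neg, C_mul, map_ofNat]
  ring

theorem fPoly_aux : (100 * X ^ 11 + 4050 * X ^ 10 + 83700 * X ^ 9 +
    888975 * X ^ 8 + 3645000 * X ^ 7 - 10570500 * X ^ 6 - 107163000 * X ^ 5 + 100875375 * X ^ 4
    + 1131772500 * X ^ 3 + C (-319848750 - 1007769600 * X) * X ^ 2 + 1328602500 * X +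
      332150625 : ℤ[X][X]).degree < 12 := by
  refine lt_of_le_of_lt (b := ((11 : ℕ) : WithBot ℕ)) ?_ (by norm_cast)
  compute_degree
  exact le_rfl

theorem fPoly_monic : fPoly.Monic := by
  rw [fPoly_eq]
  exact monic_X_pow_add fPoly_aux

theorem natDegree_fPoly : fPoly.natDegree = 12 := by
  rw [fPoly_eq]
  apply natDegree_eq_of_degree_eq_some
  rw [degree_add_eq_left_of_degree_lt (by rw [degree_X_pow]; exact fPoly_aux), degree_X_pow]

theorem eq_prod_X_sub_C {R ι : Type*} [CommRing R] [IsDomain R] [Fintype ι] {p : R[X]}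
    (hp : p.Monic) (hd : p.natDegree = Fintype.card ι) {b : ι → R} (hb : Function.Injective b)
    (h : ∀ i, p.eval (b i) = 0) : p = ∏ i, (X - C (b i)) := by
  classical
  have h1 : p.roots = Finset.univ.val.map b := by
    symm
    refine Multiset.eq_of_le_of_card_le ((Multiset.le_iff_subset
      (Finset.univ.nodup.map hb)).2 fun x hx => ?_) ?_
    · obtain ⟨i, -, rfl⟩ := Multiset.mem_map.1 hx
      exact (mem_roots hp.ne_zero).2 (h i)
    · rw [Multiset.card_map]
      exact (card_roots' p).trans hd.le
  have h2 := prod_multiset_X_sub_C_of_monic_of_roots_card_eq hp (by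
    rw [h1, Multiset.card_map, hd]; rfl)
  rw [← h2, h1, Multiset.map_map]
  rfl

section Series

variable {k : Type*} [Field k]

/-- The substitution `f(w) ↦ ζ ^ m * f(w / ζ ^ m)` for a tenth root of unity `ζ`. -/
noncomputable def twist (ζ : k) (m : ℕ) (f : PowerSeries k) : PowerSeries k :=
  PowerSeries.C (ζ ^ m) * PowerSeries.rescale (ζ ^ (9 * m)) f

theorem coeff_twist_pow (ζ : k) (m j n : ℕ) (f : PowerSeries k) :
    PowerSeries.coeff n (twist ζ m f ^ j) =
      (ζ ^ m) ^ (j + 9 * n) * PowerSeries.coeff n (f ^ j) := by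
  rw [twist, mul_pow, ← map_pow, ← map_pow, PowerSeries.coeff_C_mul, PowerSeries.coeff_rescale]
  ring

theorem twist_twist (ζ : k) (m n : ℕ) (f : PowerSeries k) :
    twist ζ m (twist ζ n f) = twist ζ (m + n) f := by
  ext i
  have h := coeff_twist_pow ζ m 1 i (twist ζ n f)
  have h' := coeff_twist_pow ζ n 1 i f
  have h'' := coeff_twist_pow ζ (m + n) 1 i f
  simp only [pow_one] at h h' h''
  rw [h, h', h'']
  ring

theorem twist_X {ζ : k} (hζ : ζ ^ 10 = 1) (m : ℕ) : twist ζ m PowerSeries.X = PowerSeries.X := by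
  rw [twist, PowerSeries.rescale_X, ← mul_assoc, ← map_mul, ← pow_add,
    show m + 9 * m = 10 * m by ring, pow_mul, hζ, one_pow, map_one, one_mul]

theorem twist_ten {ζ : k} (hζ : ζ ^ 10 = 1) (f : PowerSeries k) : twist ζ 10 f = f := by
  ext i
  have h := coeff_twist_pow ζ 10 1 i f
  simpa [hζ] using h

theorem evalTerms_twist {ζ : k} (hζ : ζ ^ 10 = 1) (m : ℕ) {y : PowerSeries k}
    (h : evalTerms [PowerSeries.X, y] fStar = 0) :
    evalTerms [PowerSeries.X, twist ζ m y] fStar = 0 := by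
  have h3 := twist_X hζ m
  have h12 : PowerSeries.C (ζ ^ m) ^ 12 = PowerSeries.C (ζ ^ m) ^ 2 := by
    rw [← map_pow, ← map_pow, ← pow_mul, ← pow_mul, mul_comm m 12,
      show 12 * m = 10 * m + m * 2 by ring, pow_add, pow_mul ζ 10, hζ, one_pow, one_mul]
  unfold twist at h3 ⊢
  generalize PowerSeries.C (ζ ^ m) = u at h12 h3 ⊢
  have h1 := evalTerms_scaled u (u ^ 2) [1, 1]
    [PowerSeries.rescale (ζ ^ (9 * m)) PowerSeries.X, PowerSeries.rescale (ζ ^ (9 * m)) y] fStar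
    le_rfl (by simp [fStar, h12])
  have h2 := congrArg (PowerSeries.rescale (ζ ^ (9 * m))) h
  rw [map_evalTerms, map_zero] at h2
  simp only [List.map_cons, List.map_nil] at h2
  rw [h2, mul_zero] at h1
  simp only [List.zipWith_cons_cons, List.zipWith_nil_left, pow_one] at h1
  rwa [h3] at h1

theorem hexPoly_twist {ι : Type*} [Fintype ι] [DecidableEq ι] {ζ : k} (hζ : ζ ^ 10 = 1) (m : ℕ)
    (S : Finset ι) (b : ι → PowerSeries k) {N : ℕ}
    (h : PowerSeries.X ^ N ∣ hexPoly PowerSeries.X S b) :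
    PowerSeries.X ^ N ∣ hexPoly PowerSeries.X S fun i => twist ζ m (b i) := by
  have h1 := hexPoly_scaled (PowerSeries.C (ζ ^ m))
    (PowerSeries.rescale (ζ ^ (9 * m)) PowerSeries.X) S
    (fun i => PowerSeries.rescale (ζ ^ (9 * m)) (b i))
  have h3 := twist_X hζ m
  unfold twist at h3 ⊢
  rw [h3] at h1
  rw [h1]
  refine Dvd.dvd.mul_left ?_ _
  have h4 := map_hexPoly (PowerSeries.rescale (ζ ^ (9 * m))) PowerSeries.X S b
  rw [← h4, PowerSeries.X_pow_dvd_iff]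
  intro n hn
  rw [PowerSeries.coeff_rescale, PowerSeries.X_pow_dvd_iff.1 h n hn, mul_zero]

/-- Existence of an exact root near an approximate integral one. -/
theorem exists_series_root (ts : List (ℤ × List ℕ)) (c : k) (Y : ℤ[X]) {N : ℕ} (hN : N ≠ 0)
    (hY : X ^ N ∣ evalTerms [X, Y] ts) (hY0 : ((Y.coeff 0 : ℤ) : k) = c)
    (hd : (derivative (evalTerms [0, X] ts : k[X])).eval c ≠ 0) :
    ∃ y : PowerSeries k, evalTerms [PowerSeries.X, y] ts = 0 ∧
      PowerSeries.X ^ N ∣ y - ((Y.map (Int.castRingHom k) : k[X]) : PowerSeries k) ∧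
      PowerSeries.constantCoeff y = c ∧
      ∀ y', evalTerms [PowerSeries.X, y'] ts = 0 → PowerSeries.constantCoeff y' = c → y' = y := by
  set a : PowerSeries k := ((Y.map (Int.castRingHom k) : k[X]) : PowerSeries k) with ha
  set G : (PowerSeries k)[X] := evalTerms [C PowerSeries.X, X] ts with hG
  have hGe : ∀ z, G.eval z = evalTerms [PowerSeries.X, z] ts := fun z => by
    rw [hG, ← coe_evalRingHom, map_evalTerms]; simp
  have hGd : ∀ z, PowerSeries.constantCoeff z = c →
      PowerSeries.constantCoeff (G.derivative.eval z) ≠ 0 := by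
    intro z hz
    rw [← eval₂_at_apply, hz, ← eval_map, ← derivative_map, hG, ← coe_mapRingHom, map_evalTerms]
    simpa using hd
  have ha0 : PowerSeries.constantCoeff a = c := by
    rw [← hY0, ha, ← PowerSeries.coeff_zero_eq_constantCoeff_apply, coeff_coe, coeff_map]; rfl
  have hGa : PowerSeries.X ^ N ∣ G.eval a := by
    rw [hGe]
    have := map_dvd ((coeToPowerSeries.ringHom (R := k)).comp (mapRingHom (Int.castRingHom k))) hY
    rw [map_evalTerms] at this
    simp only [List.map_cons, List.map_nil, map_pow, RingHom.comp_apply, coe_mapRingHom, map_X,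
      coeToPowerSeries.ringHom_apply, coe_X] at this
    exact this
  obtain ⟨y, hy, hya⟩ := exists_root_of_X_dvd G ((dvd_pow_self _ hN).trans hGa) (hGd a ha0)
  have hy0 : PowerSeries.constantCoeff y = c := by rw [constantCoeff_eq_of_X_dvd_sub hya, ha0]
  refine ⟨y, by rw [← hGe, hy], X_pow_dvd_root_sub G hy hya hGa (hGd a ha0), hy0,
    fun y' hy' hy0' => ?_⟩
  ext n
  have hd' : PowerSeries.X ∣ y' - y := by
    rw [PowerSeries.X_dvd_iff, map_sub, hy0, hy0', sub_self]
  have := X_pow_dvd_root_sub G (n := n + 1) ((hGe y').trans hy') hd' (hy ▸ dvd_zero _) (hGd y hy0)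
  have := PowerSeries.X_pow_dvd_iff.1 this n (by omega)
  rwa [map_sub, sub_eq_zero] at this

theorem pow_five_eq_neg_one {ζ : k} (hζ : IsPrimitiveRoot ζ 10) : ζ ^ 5 = -1 := by
  have h : (ζ ^ 5) ^ 2 = 1 := by rw [← pow_mul]; exact hζ.pow_eq_one
  exact (sq_eq_one_iff.1 h).resolve_left
    (hζ.pow_ne_one_of_pos_of_lt (by norm_num) (by norm_num))

theorem charSum_eq {ζ : k} (hζ : IsPrimitiveRoot ζ 10) (j n : ℕ) :
    (charSum j n : k) = (ζ ^ 2) ^ (j + 9 * n) + (ζ ^ 4) ^ (j + 9 * n) + (ζ ^ 6) ^ (j + 9 * n) +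
      (ζ ^ 8) ^ (j + 9 * n) + (ζ ^ 5) ^ (j + 9 * n) - (ζ ^ 0) ^ (j + 9 * n)
      - (ζ ^ 1) ^ (j + 9 * n) - (ζ ^ 3) ^ (j + 9 * n) - (ζ ^ 7) ^ (j + 9 * n) -
      (ζ ^ 9) ^ (j + 9 * n) := by
  set m := j + 9 * n with hm
  have hcomm : ∀ i, (ζ ^ i) ^ m = (ζ ^ m) ^ i := fun i => by rw [← pow_mul, mul_comm, pow_mul]
  have h5 : (ζ ^ m) ^ 5 = (-1) ^ m := by rw [← hcomm, pow_five_eq_neg_one hζ]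
  simp only [hcomm]
  set x := ζ ^ m with hx
  unfold charSum
  by_cases h1 : (n + 9 * j) % 10 = 5
  · have : x = -1 := by
      rw [← pow_five_eq_neg_one hζ, hx, show m = 10 * (m / 10) + 5 by omega, pow_add, pow_mul,
        hζ.pow_eq_one, one_pow, one_mul]
    rw [if_pos h1, this]
    push_cast
    ring
  · rw [if_neg h1]
    rcases Nat.even_or_odd m with h2 | h2
    · rw [h2.neg_one_pow] at h5
      rw [if_neg (by have := h2.two_dvd; omega)]
      push_cast
      linear_combination (-(x + x ^ 3 + 1 - x ^ 2 - x ^ 4)) * h5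
    · rw [h2.neg_one_pow] at h5
      rw [if_pos (by have := Nat.odd_iff.1 h2; omega)]
      have h3 : x + 1 ≠ 0 := by
        intro h
        have h5' : ζ ^ (m % 10) = ζ ^ 5 := by
          rw [pow_five_eq_neg_one hζ, hζ.eq_orderOf, pow_mod_orderOf]
          exact eq_neg_of_add_eq_zero_left h
        have := hζ.pow_inj (Nat.mod_lt _ (by norm_num)) (by norm_num) h5'
        omega
      have h4 : x ^ 4 - x ^ 3 + x ^ 2 - x + 1 = 0 :=
        (mul_eq_zero.1 (show (x + 1) * (x ^ 4 - x ^ 3 + x ^ 2 - x + 1) = 0 by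
          linear_combination h5)).resolve_left h3
      push_cast
      linear_combination (-(x + x ^ 3 + 1 - x ^ 2 - x ^ 4)) * h5 - 2 * h4

theorem oddPart_eq {ζ : k} (hζ : IsPrimitiveRoot ζ 10) (j n : ℕ) :
    (oddPart j n : k) = 1 - (ζ ^ 5) ^ (j + 9 * n) := by
  rw [pow_five_eq_neg_one hζ, oddPart]
  rcases Nat.even_or_odd (j + 9 * n) with h | h
  · rw [h.neg_one_pow, if_neg (by have := h.two_dvd; omega)]; simp
  · rw [h.neg_one_pow, if_pos (by have := Nat.odd_iff.1 h; omega)]; push_cast; ring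

end Series

section Branches

variable {k : Type*} [Field k]

theorem rescale_eq_self {u : k} (hu : u ^ 5 = 1) {z : PowerSeries k}
    (hz : evalTerms [PowerSeries.X, z] gStar = 0)
    (huniq : ∀ z', evalTerms [PowerSeries.X, z'] gStar = 0 →
      PowerSeries.constantCoeff z' = PowerSeries.constantCoeff z → z' = z) :
    PowerSeries.rescale u z = z := by
  apply huniq
  · have hv : ∀ n, PowerSeries.C u ^ (5 * n) = 1 := fun n => by
      rw [pow_mul, ← map_pow, hu, map_one, one_pow]
    have h2 := congrArg (PowerSeries.rescale u) hz
    rw [map_evalTerms, map_zero] at h2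
    simp only [List.map_cons, List.map_nil, PowerSeries.rescale_X] at h2
    generalize PowerSeries.C u = v at hv h2
    have h1 := evalTerms_scaled v 1 [1, 0] [PowerSeries.X, PowerSeries.rescale u z] gStar le_rfl (by
      simp [gStar, hv 1, hv 2, hv 3, hv 4, hv 5, hv 6, hv 7, hv 8, hv 9, hv 10, hv 11, hv 12])
    simpa only [List.zipWith_cons_cons, List.zipWith_nil_left, pow_one, pow_zero, one_mul, h2]
      using h1.symm
  · rw [← PowerSeries.coeff_zero_eq_constantCoeff_apply, PowerSeries.coeff_rescale]
    simp

theorem twist_two {ζ : k} (hζ : ζ ^ 10 = 1) {z : PowerSeries k}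
    (hz : evalTerms [PowerSeries.X, z] gStar = 0)
    (huniq : ∀ z', evalTerms [PowerSeries.X, z'] gStar = 0 →
      PowerSeries.constantCoeff z' = PowerSeries.constantCoeff z → z' = z) :
    twist ζ 2 (PowerSeries.X ^ 6 * z) = PowerSeries.X ^ 6 * z := by
  have h18 : (ζ ^ (9 * 2)) ^ 5 = 1 := by
    rw [← pow_mul, show 9 * 2 * 5 = 10 * 9 by norm_num, pow_mul, hζ, one_pow]
  rw [twist, map_mul (PowerSeries.rescale _), map_pow (PowerSeries.rescale _),
    rescale_eq_self h18 hz huniq, PowerSeries.rescale_X, mul_pow, ← map_pow PowerSeries.C,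
    ← mul_assoc, ← mul_assoc, ← map_mul, ← pow_mul, ← pow_add,
    show 2 + 9 * 2 * 6 = 10 * 11 by norm_num, pow_mul, hζ, one_pow, map_one, one_mul]

/-- The twelve branches at infinity. -/
noncomputable def branch (ζ : k) (y u : PowerSeries k) (i : Fin 12) : PowerSeries k :=
  if (i : ℕ) < 10 then twist ζ i y else if (i : ℕ) = 10 then u else twist ζ 5 u

/-- The action of the local monodromy on the branches. -/
def rotation : Equiv.Perm (Fin 12) where
  toFun := ![1, 2, 3, 4, 5, 6, 7, 8, 9, 0, 11, 10]
  invFun := ![9, 0, 1, 2, 3, 4, 5, 6, 7, 8, 11, 10]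
  left_inv := by decide
  right_inv := by decide

theorem twist_branch {ζ : k} (hζ : ζ ^ 10 = 1) (y : PowerSeries k) {u : PowerSeries k}
    (hu : twist ζ 2 u = u) (i : Fin 12) :
    twist ζ 1 (branch ζ y u i) = branch ζ y u (rotation i) := by
  have h4 : twist ζ 4 u = u := by rw [show 4 = 2 + 2 from rfl, ← twist_twist, hu, hu]
  have h1 : twist ζ 1 u = twist ζ 5 u := by rw [show 5 = 1 + 4 from rfl, ← twist_twist, h4]
  have h6 : twist ζ 6 u = u := by rw [show 6 = 2 + 4 from rfl, ← twist_twist, h4, hu]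
  have h0 : twist ζ 0 y = y := by simp [twist]
  fin_cases i <;> simp [branch, rotation, twist_twist, h1, h6, h0, twist_ten hζ]

theorem branch_injective {ζ : k} [CharZero k] (hζ : IsPrimitiveRoot ζ 10) {y z : PowerSeries k}
    (hy : PowerSeries.constantCoeff y = 1) (hz : PowerSeries.constantCoeff z = 18225) :
    Function.Injective (branch ζ y (PowerSeries.X ^ 6 * z)) := by
  set u := PowerSeries.X ^ 6 * z with hu
  have hu6 : PowerSeries.coeff 6 u = 18225 := by
    have := PowerSeries.coeff_X_pow_mul z 6 0
    rw [zero_add] at this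
    rw [hu, this, PowerSeries.coeff_zero_eq_constantCoeff_apply, hz]
  have hu0 : PowerSeries.coeff 0 u = 0 := by simp [hu]
  have hy0 : PowerSeries.coeff 0 y = 1 := by simp [hy]
  have hc : ∀ m n f, PowerSeries.coeff n (twist ζ m f) = (ζ ^ m) ^ (1 + 9 * n) *
      PowerSeries.coeff n f := fun m n f => by simpa using coeff_twist_pow ζ m 1 n f
  have hζ0 : ζ ≠ 0 := hζ.ne_zero (by norm_num)
  have h10 : ∀ i : Fin 12, (i : ℕ) < 10 → PowerSeries.coeff 0 (branch ζ y u i) = ζ ^ (i : ℕ) :=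
    fun i hi => by simp [branch, hi, hc, hy]
  have h11 : ∀ i : Fin 12, ¬ (i : ℕ) < 10 → PowerSeries.coeff 0 (branch ζ y u i) = 0 :=
    fun i hi => by
      rw [branch, if_neg hi]
      split_ifs
      · exact hu0
      · rw [hc, hu0, mul_zero]
  have h5 : PowerSeries.coeff 6 (twist ζ 5 u) = -18225 := by
    rw [hc, hu6, pow_five_eq_neg_one hζ]; norm_num
  have hne : twist ζ 5 u ≠ u := fun h => by
    rw [h, hu6] at h5; norm_num [eq_neg_iff_add_eq_zero] at h5
  intro i j hij
  have h := congrArg (PowerSeries.coeff 0) hij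
  by_cases hi : (i : ℕ) < 10 <;> by_cases hj : (j : ℕ) < 10
  · rw [h10 i hi, h10 j hj] at h
    exact Fin.ext (hζ.pow_inj hi hj h)
  · rw [h10 i hi, h11 j hj] at h
    exact absurd h (pow_ne_zero _ hζ0)
  · rw [h11 i hi, h10 j hj] at h
    exact absurd h.symm (pow_ne_zero _ hζ0)
  · simp only [branch, if_neg hi, if_neg hj] at hij
    ext
    split_ifs at hij with h1 h2 h2
    · omega
    · exact absurd hij.symm hne
    · exact absurd hij hne
    · omega

/-- A hexad fixed by no proper power of the rotation. -/
def baseHexad : Finset (Fin 12) := {2, 4, 5, 6, 8, 10}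

theorem signedPowerSum_baseHexad {R : Type*} [CommRing R] (b : Fin 12 → R) (j : ℕ) :
    signedPowerSum baseHexad b j = b 2 ^ j + b 4 ^ j + b 6 ^ j + b 8 ^ j + b 5 ^ j - b 0 ^ j
      - b 1 ^ j - b 3 ^ j - b 7 ^ j - b 9 ^ j + b 10 ^ j - b 11 ^ j := by
  have h : ∀ i : Fin 12, (if i ∈ baseHexad then 1 else -1 : R) =
      ![-1, -1, 1, -1, 1, 1, 1, -1, 1, -1, 1, -1] i := by
    intro i
    fin_cases i <;> rfl
  simp only [signedPowerSum, h]
  rw [Fin.sum_univ_castSucc, Fin.sum_univ_castSucc, Fin.sum_univ_castSucc, Fin.sum_univ_castSucc,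
    Fin.sum_univ_eight]
  change -1 * b 0 ^ j + -1 * b 1 ^ j + 1 * b 2 ^ j + -1 * b 3 ^ j + 1 * b 4 ^ j + 1 * b 5 ^ j +
    1 * b 6 ^ j + -1 * b 7 ^ j + 1 * b 8 ^ j + -1 * b 9 ^ j + 1 * b 10 ^ j + -1 * b 11 ^ j = _
  ring

theorem X_pow_dvd_hexPoly_branch {ζ : k} (hζ : IsPrimitiveRoot ζ 10) {N : ℕ}
    {y u : PowerSeries k} {Y U : ℤ[X]} {S : ℕ → ℤ[X]}
    (hy : PowerSeries.X ^ N ∣ y - ((Y.map (Int.castRingHom k) : k[X]) : PowerSeries k))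
    (hu : PowerSeries.X ^ N ∣ u - ((U.map (Int.castRingHom k) : k[X]) : PowerSeries k))
    (hS : ∀ j < 7, ∀ n < N,
      (S j).coeff n = charSum j n * (Y ^ j).coeff n + oddPart j n * (U ^ j).coeff n)
    (hP : X ^ N ∣ evalTerms [X, S 1, S 2, S 3, S 4, S 5, S 6] hexTerms) :
    PowerSeries.X ^ N ∣ hexPoly PowerSeries.X baseHexad (branch ζ y u) := by
  set ι := (coeToPowerSeries.ringHom (R := k)).comp (mapRingHom (Int.castRingHom k)) with hι
  have hιc : ∀ f n, PowerSeries.coeff n (ι f) = f.coeff n := fun f n => by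
    simp [hι, RingHom.comp_apply, coeToPowerSeries.ringHom_apply]
  have hιX : ι X = PowerSeries.X := by
    simp [hι, RingHom.comp_apply, coeToPowerSeries.ringHom_apply]
  change PowerSeries.X ^ N ∣ y - ι Y at hy
  change PowerSeries.X ^ N ∣ u - ι U at hu
  have hpow : ∀ {f : PowerSeries k} {F : ℤ[X]}, PowerSeries.X ^ N ∣ f - ι F → ∀ j, ∀ n < N,
      PowerSeries.coeff n (f ^ j) = (((F ^ j).coeff n : ℤ) : k) := by
    intro f F h j n hn
    have h1 := PowerSeries.X_pow_dvd_iff.1 (h.trans (sub_dvd_pow_sub_pow f (ι F) j)) n hn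
    rw [map_sub, sub_eq_zero, ← map_pow ι, hιc] at h1
    exact h1
  have hsum : ∀ j < 7, PowerSeries.X ^ N ∣ signedPowerSum baseHexad (branch ζ y u) j - ι (S j) := by
    intro j hj
    rw [PowerSeries.X_pow_dvd_iff]
    intro n hn
    rw [map_sub, hιc, hS j hj n hn, Int.cast_add, Int.cast_mul, Int.cast_mul, charSum_eq hζ,
      oddPart_eq hζ, ← hpow hy j n hn, ← hpow hu j n hn]
    have hb : ∀ (i : Fin 12), (i : ℕ) < 10 → PowerSeries.coeff n (branch ζ y u i ^ j) =
        (ζ ^ (i : ℕ)) ^ (j + 9 * n) * PowerSeries.coeff n (y ^ j) := fun i hi => by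
      rw [branch, if_pos hi, coeff_twist_pow]
    have h11 : PowerSeries.coeff n (branch ζ y u 11 ^ j) =
        (ζ ^ 5) ^ (j + 9 * n) * PowerSeries.coeff n (u ^ j) := coeff_twist_pow ζ 5 j n u
    have h10 : branch ζ y u 10 = u := rfl
    simp only [signedPowerSum_baseHexad, map_add, map_sub, h10, h11]
    rw [hb 0 (by decide), hb 1 (by decide), hb 2 (by decide), hb 3 (by decide), hb 4 (by decide),
      hb 5 (by decide), hb 6 (by decide), hb 7 (by decide), hb 8 (by decide), hb 9 (by decide)]
    change (ζ ^ 2) ^ (j + 9 * n) * _ + (ζ ^ 4) ^ (j + 9 * n) * _ + (ζ ^ 6) ^ (j + 9 * n) * _ +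
      (ζ ^ 8) ^ (j + 9 * n) * _ + (ζ ^ 5) ^ (j + 9 * n) * _ - (ζ ^ 0) ^ (j + 9 * n) * _ -
      (ζ ^ 1) ^ (j + 9 * n) * _ - (ζ ^ 3) ^ (j + 9 * n) * _ - (ζ ^ 7) ^ (j + 9 * n) * _ -
      (ζ ^ 9) ^ (j + 9 * n) * _ + _ - _ - _ = _
    ring
  have h1 := map_dvd ι hP
  rw [map_evalTerms, map_pow, hιX] at h1
  unfold hexPoly
  rw [← dvd_sub_left h1]
  refine dvd_evalTerms_sub (.cons (by rw [hιX, sub_self]; exact dvd_zero _) (.cons (hsum 1 ?_)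
    (.cons (hsum 2 ?_) (.cons (hsum 3 ?_) (.cons (hsum 4 ?_) (.cons (hsum 5 ?_) (.cons (hsum 6 ?_)
    .nil))))))) _ <;> norm_num

theorem X_pow_dvd_prod_hexPoly {ζ : k} (hζ : ζ ^ 10 = 1) {N : ℕ} {γ : Fin 12 → PowerSeries k}
    (hγ : ∀ i, twist ζ 1 (γ i) = γ (rotation i))
    (h : PowerSeries.X ^ N ∣ hexPoly PowerSeries.X baseHexad γ) :
    PowerSeries.X ^ (N * 10) ∣
      ∏ S ∈ Finset.powersetCard 6 Finset.univ, hexPoly PowerSeries.X S γ := by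
  set T : ℕ → Finset (Fin 12) := fun m => (Finset.map rotation.toEmbedding)^[m] baseHexad with hT
  have hm : ∀ m, PowerSeries.X ^ N ∣ hexPoly PowerSeries.X (T m) γ := by
    intro m
    induction m with
    | zero => exact h
    | succ m ih =>
      rw [hT]
      simp only [Function.iterate_succ_apply']
      rw [hexPoly_map]
      have := hexPoly_twist hζ 1 _ _ ih
      simpa only [hγ] using this
  have hinj : Set.InjOn T (Finset.range 10 : Finset ℕ) := by
    have : ∀ a ∈ Finset.range 10, ∀ b ∈ Finset.range 10, T a = T b → a = b := by decide
    intro a ha b hb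
    exact this a (by simpa using ha) b (by simpa using hb)
  have hsub : (Finset.range 10).image T ⊆ Finset.powersetCard 6 Finset.univ := by
    intro S hS
    obtain ⟨m, -, rfl⟩ := Finset.mem_image.1 hS
    rw [Finset.mem_powersetCard]
    refine ⟨Finset.subset_univ _, ?_⟩
    clear hS
    induction m with
    | zero => rfl
    | succ m ih =>
      rw [hT] at ih ⊢
      simp only [Function.iterate_succ_apply', Finset.card_map] at ih ⊢
      exact ih
  refine dvd_trans ?_ (Finset.prod_dvd_prod_of_subset _ _ _ hsub)
  rw [Finset.prod_image hinj]
  have := Finset.prod_dvd_prod_of_dvd (s := Finset.range 10) (fun _ => PowerSeries.X ^ N)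
    (fun m => hexPoly PowerSeries.X (T m) γ) fun m _ => hm m
  rwa [Finset.prod_const, Finset.card_range, ← pow_mul] at this

variable (k) in
theorem exists_branches [CharZero k] {ζ : k} (hζ : IsPrimitiveRoot ζ 10) :
    ∃ γ : Fin 12 → PowerSeries k, Function.Injective γ ∧
      (∀ i, evalTerms [PowerSeries.X, γ i] fStar = 0) ∧
      PowerSeries.X ^ 10240 ∣
        ∏ S ∈ Finset.powersetCard 6 Finset.univ, hexPoly PowerSeries.X S γ := by
  have h10 := hζ.pow_eq_one
  obtain ⟨Y, Z, S, hY0, hZ0, hY, hZ, hS, hP⟩ := exists_approx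
  obtain ⟨y, hy, hyY, hy0, -⟩ := exists_series_root (k := k) fStar 1 Y (by norm_num) hY
    (by rw [hY0, Int.cast_one])
    (by simp [evalTerms, fStar]; norm_num)
  obtain ⟨z, hz, hzZ, hz0, huniq⟩ := exists_series_root (k := k) gStar 18225 Z (by norm_num) hZ
    (by rw [hZ0]; norm_num)
    (by simp [evalTerms, gStar])
  have hu := twist_two h10 hz (by rwa [hz0])
  refine ⟨branch ζ y (PowerSeries.X ^ 6 * z), branch_injective hζ hy0 hz0, ?_, ?_⟩
  · have hu0 : evalTerms [PowerSeries.X, PowerSeries.X ^ 6 * z] fStar = 0 := by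
      have : evalTerms [PowerSeries.X, PowerSeries.X ^ 6 * z] fStar =
          PowerSeries.X ^ 12 * evalTerms [PowerSeries.X, z] gStar := by
        simp only [evalTerms, fStar, gStar, List.map_cons, List.map_nil, List.zipWith_cons_cons,
          List.zipWith_nil_left, List.prod_cons, List.prod_nil, List.sum_cons, List.sum_nil]
        ring
      rw [this, hz, mul_zero]
    intro i
    unfold branch
    split_ifs
    exacts [evalTerms_twist h10 _ hy, hu0, evalTerms_twist h10 _ hu0]
  · rw [show 10240 = 2 ^ 10 * 10 by norm_num]
    refine X_pow_dvd_prod_hexPoly (N := 2 ^ 10) h10 (twist_branch h10 y hu)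
      (X_pow_dvd_hexPoly_branch (U := X ^ 6 * Z) hζ hyY ?_ hS hP)
    have : ((Polynomial.map (Int.castRingHom k) (X ^ 6 * Z) : k[X]) : PowerSeries k) =
        PowerSeries.X ^ 6 * ((Z.map (Int.castRingHom k) : k[X]) : PowerSeries k) := by simp
    rw [this, ← mul_sub]
    exact hzZ.mul_left _

end Branches

theorem exists_prod_hexPoly_eq : ∃ a : ℤ[X], ∀ {R : Type} [CommRing R] (φ : ℤ[X] →+* R)
    (b : Fin 12 → R), fPoly.map φ = ∏ i, (X - C (b i)) →
      ∏ S ∈ Finset.powersetCard 6 Finset.univ, hexPoly 1 S b = φ a := by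
  let N : MvPolynomial (Fin 12) ℤ :=
    ∏ S ∈ Finset.powersetCard 6 Finset.univ, hexPoly 1 S MvPolynomial.X
  have hN : N.IsSymmetric := by
    intro e
    simp only [N, map_prod]
    refine Finset.prod_bij (fun S _ => S.map e.toEmbedding) ?_ ?_ ?_ ?_
    · intro S hS
      rw [Finset.mem_powersetCard] at hS ⊢
      exact ⟨Finset.subset_univ _, by rw [Finset.card_map, hS.2]⟩
    · intro S _ T _ h
      exact Finset.map_injective _ h
    · intro S hS
      refine ⟨S.map e.symm.toEmbedding, ?_, ?_⟩
      · rw [Finset.mem_powersetCard] at hS ⊢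
        exact ⟨Finset.subset_univ _, by rw [Finset.card_map, hS.2]⟩
      · ext i; simp
    · intro S _
      rw [hexPoly_map]
      have := map_hexPoly (MvPolynomial.rename (R := ℤ) e).toRingHom 1 S MvPolynomial.X
      simpa using this
  obtain ⟨T, hT⟩ := MvPolynomial.esymmAlgHom_surjective (n := 12) (σ := Fin 12) ℤ
    (by simp) ⟨N, hN⟩
  have hT' := congrArg Subtype.val hT
  rw [MvPolynomial.esymmAlgHom_apply] at hT'
  refine ⟨MvPolynomial.aeval (fun i : Fin 12 => (-1) ^ (i + 1 : ℕ) * fPoly.coeff (11 - i)) T, ?_⟩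
  intro R _ φ b h
  have h1 : ∏ S ∈ Finset.powersetCard 6 Finset.univ, hexPoly 1 S b = MvPolynomial.aeval b N := by
    simp only [N, map_prod]
    refine Finset.prod_congr rfl fun S _ => ?_
    have := map_hexPoly (MvPolynomial.aeval (R := ℤ) b).toRingHom 1 S MvPolynomial.X
    simpa using this.symm
  have h2 : ∀ g : Fin 12 → ℤ[X], φ (MvPolynomial.aeval g T) =
      MvPolynomial.aeval (fun i => φ (g i)) T := fun g => by
    rw [MvPolynomial.map_aeval, MvPolynomial.aeval_def, MvPolynomial.coe_eval₂Hom]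
    congr 1
    exact RingHom.ext_int _ _
  change MvPolynomial.aeval _ T = N at hT'
  rw [h1, ← hT', h2, MvPolynomial.comp_aeval_apply]
  congr 2
  funext i
  rw [MvPolynomial.aeval_esymm_eq_multiset_esymm, map_mul, map_pow,
    map_neg, map_one, ← coeff_map, h]
  have h3 : ∏ i, (X - C (b i)) = ((Finset.univ.val.map b).map fun t => X - C t).prod := by
    rw [Multiset.map_map]; rfl
  have hc : (Finset.univ.val.map b).card = 12 := by simp
  rw [h3, Multiset.prod_X_sub_C_coeff _ (by omega), hc, show 12 - (11 - (i : ℕ)) = i + 1 by omega,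
    ← mul_assoc, ← pow_add, ← two_mul, pow_mul]
  simp

theorem eq_zero_of_branches {M : Type} [Field M] {ι : PowerSeries ℂ →+* M}
    (hι : Function.Injective ι) {a : ℤ[X]}
    (ha : ∀ (φ : ℤ[X] →+* M) (b : Fin 12 → M), fPoly.map φ = ∏ i, (X - C (b i)) →
      ∏ S ∈ Finset.powersetCard 6 Finset.univ, hexPoly 1 S b = φ a) : a = 0 := by
  by_contra h0
  obtain ⟨γ, hγ, hroot, q, hq⟩ :=
    exists_branches ℂ (Complex.isPrimitiveRoot_exp 10 (by norm_num))
  set v : M := ι PowerSeries.X with hv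
  have hv0 : v ≠ 0 := (map_ne_zero_iff ι hι).2 PowerSeries.X_ne_zero
  let t : PowerSeries ℂ := 1007769600 * PowerSeries.X ^ 10
  have hιt : ι t = 1007769600 * v ^ 10 := by rw [map_mul, map_pow, map_ofNat]
  have ht0 : ι t ≠ 0 := by
    rw [hιt]
    refine mul_ne_zero ?_ (pow_ne_zero _ hv0)
    have : ι (PowerSeries.C 1007769600) ≠ 0 := (map_ne_zero_iff ι hι).2 (by simp)
    simpa only [map_ofNat] using this
  set s : M := (ι t)⁻¹ with hs
  have hst : 1007769600 * s * v ^ 10 = 1 := by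
    rw [mul_right_comm, ← hιt, hs, mul_inv_cancel₀ ht0]
  let ψ : ℤ[X] →+* M := eval₂RingHom (Int.castRingHom M) s
  have hψX : ψ X = s := eval₂_X _ _
  have hroot' : ∀ i, (fPoly.map ψ).eval (ι (γ i) / v) = 0 := by
    intro i
    rw [eval_map_fPoly, hψX]
    have h1 := congrArg ι (hroot i)
    rw [map_evalTerms, map_zero] at h1
    have h2 : ι (γ i) = v * (ι (γ i) / v) := by field_simp
    simp only [List.map_cons, List.map_nil] at h1
    rw [h2] at h1
    generalize ι (γ i) / v = c at h1
    refine (mul_eq_zero.1 (?_ : v ^ 12 * _ = 0)).resolve_left (pow_ne_zero 12 hv0)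
    rw [← h1]
    simp only [evalTerms, fStar, fTerms, List.map_cons, List.map_nil, List.zipWith_cons_cons,
      List.zipWith_nil_left, List.prod_cons, List.prod_nil, List.sum_cons, List.sum_nil]
    push_cast
    linear_combination (-v ^ 2 * c ^ 2) * hst
  have hbinj : Function.Injective fun i => ι (γ i) / v := by
    intro i j h
    exact hγ (hι ((div_left_inj' hv0).1 h))
  have h1 := ha ψ _ (eq_prod_X_sub_C (fPoly_monic.map ψ)
    (by rw [fPoly_monic.natDegree_map, natDegree_fPoly]; rfl) hbinj hroot')
  have h2 : ι (∏ S ∈ Finset.powersetCard 6 Finset.univ, hexPoly PowerSeries.X S γ) =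
      v ^ 9240 * ψ a := by
    have h3 : ∀ S : Finset (Fin 12), ι (hexPoly PowerSeries.X S γ) =
        v ^ 10 * hexPoly 1 S fun i => ι (γ i) / v := by
      intro S
      rw [map_hexPoly, ← hexPoly_scaled]
      congr 1
      · rw [mul_one]
      · funext i
        field_simp
    rw [map_prod, ← h1]
    simp only [h3]
    rw [Finset.prod_mul_distrib, Finset.prod_const, Finset.card_powersetCard, ← pow_mul]
    congr 2
  rw [hq, map_mul, map_pow, ← hv, show 10240 = 9240 + 1000 by norm_num, pow_add, mul_assoc] at h2
  have h3 : ψ a = v ^ 1000 * ι q := (mul_left_cancel₀ (pow_ne_zero _ hv0) h2).symm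
  let _ : Invertible s := invertibleOfNonzero (inv_ne_zero ht0)
  have h4 := eval₂_reverse_mul_pow (Int.castRingHom M) s a
  have h5 : ⅟s = ι t := by rw [invOf_eq_inv, hs, inv_inv]
  have h6 : eval₂ (Int.castRingHom M) (ι t) a.reverse =
      ι (eval₂ (Int.castRingHom (PowerSeries ℂ)) t a.reverse) := by
    rw [hom_eval₂]
    congr 1
    exact RingHom.ext_int _ _
  have h7 : ι (eval₂ (Int.castRingHom (PowerSeries ℂ)) t a.reverse) =
      ι (PowerSeries.X ^ 1000 * q * t ^ a.natDegree) := by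
    rw [← h6, ← h5, map_mul, map_mul, map_pow, ← hv, ← h3, map_pow]
    change _ = eval₂ (Int.castRingHom M) s a * _
    rw [← h4, mul_assoc, ← mul_pow, ← h5, mul_invOf_self, one_pow, mul_one]
  have h8 := congrArg PowerSeries.constantCoeff (hι h7)
  have h9 : PowerSeries.constantCoeff t = 0 := by simp [t]
  have h10 : PowerSeries.constantCoeff (PowerSeries.X ^ 1000 * q * t ^ a.natDegree) = 0 := by
    rw [map_mul, map_mul, map_pow, PowerSeries.constantCoeff_X, zero_pow (by norm_num), zero_mul,
      zero_mul]
  rw [h10, hom_eval₂, h9, eval₂_at_zero, coeff_zero_reverse] at h8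
  exact h0 (leadingCoeff_eq_zero.1 (by simpa using h8))

/-- Over any domain in which `fPoly` splits, `hexPoly` vanishes on some six-element set. -/
theorem exists_hexPoly_eq_zero {R : Type} [CommRing R] [IsDomain R] (φ : ℤ[X] →+* R)
    (b : Fin 12 → R) (hb : fPoly.map φ = ∏ i, (X - C (b i))) :
    ∃ S : Finset (Fin 12), S.card = 6 ∧ hexPoly 1 S b = 0 := by
  obtain ⟨a, ha⟩ := exists_prod_hexPoly_eq
  suffices h0 : a = 0 by
    have h1 := ha φ b hb
    rw [h0, map_zero, Finset.prod_eq_zero_iff] at h1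
    obtain ⟨S, hS, h⟩ := h1
    exact ⟨S, (Finset.mem_powersetCard.1 hS).2, h⟩
  clear hb b φ
  exact eq_zero_of_branches
    (IsFractionRing.injective (PowerSeries ℂ) (FractionRing (PowerSeries ℂ)))
    fun φ b h => ha φ b h

section Frobenius

/-- Existence of Frobenius elements, stated with a homomorphism to a field. -/
theorem exists_frobenius {A K L : Type} [CommRing A] [IsDomain A] [IsNoetherianRing A]
    [IsIntegrallyClosed A] [Field K] [Algebra A K] [IsFractionRing A K] [Field L] [Algebra K L]
    [Algebra A L] [IsScalarTower A K L] [FiniteDimensional K L] [IsGalois K L]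
    (P : Ideal A) [P.IsMaximal] [Finite (A ⧸ P)] :
    ∃ (κ : Type) (_ : Field κ) (ψ : integralClosure A L →+* κ) (σ : Gal(L/K)),
      RingHom.ker (ψ.comp (algebraMap A (integralClosure A L))) = P ∧
      ∀ c d : integralClosure A L, (d : L) = σ c → ψ d = ψ c ^ Nat.card (A ⧸ P) := by
  let C := integralClosure A L
  have : Module.Finite A C := IsIntegralClosure.finite A K L C
  have : IsFractionRing C L := IsIntegralClosure.isFractionRing_of_finite_extension A K L C
  let _ : MulSemiringAction Gal(L/K) C := IsIntegralClosure.MulSemiringAction A K L C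
  have : Algebra.IsInvariant A C Gal(L/K) := Algebra.isInvariant_of_isGalois A K L C
  have : SMulCommClass Gal(L/K) A C := ⟨fun g a c => map_smul (galRestrict A K L C g) a c⟩
  have hinj : Function.Injective (algebraMap A C) := by
    have h : Function.Injective (algebraMap A L) := by
      rw [IsScalarTower.algebraMap_eq A K L]
      exact (algebraMap K L).injective.comp (IsFractionRing.injective A K)
    rw [IsScalarTower.algebraMap_eq A C L, RingHom.coe_comp] at h
    exact Function.Injective.of_comp h
  obtain ⟨Q, hQ, hQP⟩ := Ideal.exists_ideal_over_maximal_of_isIntegral (S := C) P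
    (by rw [(RingHom.injective_iff_ker_eq_bot _).1 hinj]; exact bot_le)
  have : Q.IsPrime := hQ.isPrime
  have : Q.LiesOver P := ⟨hQP.symm⟩
  have : Module.Finite (A ⧸ P) (C ⧸ Q) := inferInstance
  have : Finite (C ⧸ Q) := Module.finite_of_finite (A ⧸ P)
  obtain ⟨σ, hσ⟩ := IsArithFrobAt.exists_of_isInvariant A Gal(L/K) Q
  refine ⟨C ⧸ Q, Ideal.Quotient.field Q, Ideal.Quotient.mk Q, σ, ?_, ?_⟩
  · rw [← hQP, ← RingHom.comap_ker, Ideal.mk_ker]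
  · intro c d h
    have h1 := hσ c
    rw [← map_pow]
    refine Ideal.Quotient.eq.2 ?_
    have h2 : d = σ • c := by
      apply Subtype.ext
      rw [h]
      exact (algebraMap_galRestrict_apply A σ c).symm
    rw [h2]
    have : Q.under A = P := hQP
    rw [← this]
    exact h1

end Frobenius

theorem injective_map_ratFunc : Function.Injective
    ((algebraMap ℚ[X] (RatFunc ℚ)).comp (mapRingHom (Int.castRingHom ℚ))) := by
  rw [RingHom.coe_comp]
  exact (IsFractionRing.injective ℚ[X] (RatFunc ℚ)).comp
    (map_injective _ (RingHom.injective_int _))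

/-- The field `ℚ(s)` as an algebra over `ℤ[s]`. -/
noncomputable instance algebraRatFunc : Algebra ℤ[X] (RatFunc ℚ) :=
  ((algebraMap ℚ[X] (RatFunc ℚ)).comp (mapRingHom (Int.castRingHom ℚ))).toAlgebra

theorem algebraMap_ratFunc (f : ℤ[X]) : algebraMap ℤ[X] (RatFunc ℚ) f =
    algebraMap ℚ[X] (RatFunc ℚ) (f.map (Int.castRingHom ℚ)) := rfl

theorem exists_algebraMap_div (f : ℚ[X]) : ∃ (g : ℤ[X]) (c : ℤ), c ≠ 0 ∧
    algebraMap ℚ[X] (RatFunc ℚ) f = algebraMap ℤ[X] (RatFunc ℚ) g / (c : RatFunc ℚ) := by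
  obtain ⟨c, hc, h⟩ := IsLocalization.integerNormalization_spec (nonZeroDivisors ℤ) f
  have hc0 : c ≠ 0 := nonZeroDivisors.ne_zero hc
  refine ⟨IsLocalization.integerNormalization (nonZeroDivisors ℤ) f, c, hc0, ?_⟩
  rw [eq_div_iff (Int.cast_ne_zero.2 hc0), algebraMap_ratFunc]
  change _ = algebraMap ℚ[X] (RatFunc ℚ) (map (algebraMap ℤ ℚ) _)
  rw [h, mul_comm, zsmul_eq_mul, map_mul, map_intCast]

instance isFractionRing_ratFunc : IsFractionRing ℤ[X] (RatFunc ℚ) := by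
  have : FaithfulSMul ℤ[X] (RatFunc ℚ) :=
    (faithfulSMul_iff_algebraMap_injective _ _).2 injective_map_ratFunc
  refine IsFractionRing.of_field ℤ[X] (RatFunc ℚ) fun z => ?_
  obtain ⟨g, c, hc, h⟩ := exists_algebraMap_div z.num
  obtain ⟨g', c', hc', h'⟩ := exists_algebraMap_div z.denom
  refine ⟨g * (c' : ℤ[X]), g' * (c : ℤ[X]), ?_⟩
  rw [← RatFunc.num_div_denom z, h, h', map_mul, map_mul, map_intCast, map_intCast]
  field_simp

/-- Frobenius elements at the places `s = a` of good reduction modulo `p`. -/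
theorem exists_frobenius_at (L : Type) [Field L] [Algebra (RatFunc ℚ) L] [Algebra ℤ[X] L]
    [IsScalarTower ℤ[X] (RatFunc ℚ) L] [FiniteDimensional (RatFunc ℚ) L]
    [IsGalois (RatFunc ℚ) L] (p : ℕ) [Fact p.Prime] (a : ℕ) :
    ∃ (κ : Type) (_ : Field κ) (_ : CharP κ p) (ψ : integralClosure ℤ[X] L →+* κ)
      (σ : Gal(L/RatFunc ℚ)), ψ (algebraMap ℤ[X] _ X) = a ∧
      ∀ c d : integralClosure ℤ[X] L, (d : L) = σ c → ψ d = ψ c ^ p := by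
  let φ : ℤ[X] →+* ZMod p := eval₂RingHom (Int.castRingHom _) (a : ZMod p)
  have hφ : Function.Surjective φ := fun x => by
    obtain ⟨n, rfl⟩ := ZMod.intCast_surjective x
    exact ⟨C n, eval₂_C _ _⟩
  have : (RingHom.ker φ).IsMaximal := RingHom.ker_isMaximal_of_surjective φ hφ
  have e := RingHom.quotientKerEquivOfSurjective hφ
  have : Finite (ℤ[X] ⧸ RingHom.ker φ) := Finite.of_equiv _ e.symm.toEquiv
  have hcard : Nat.card (ℤ[X] ⧸ RingHom.ker φ) = p := by
    rw [Nat.card_congr e.toEquiv, Nat.card_zmod]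
  obtain ⟨κ, hκ, ψ, σ, hker, hσ⟩ := exists_frobenius (K := RatFunc ℚ) (L := L) (RingHom.ker φ)
  rw [hcard] at hσ
  have hp : (p : κ) = 0 := by
    have : (p : ℤ[X]) ∈ RingHom.ker φ := by
      rw [RingHom.mem_ker, map_natCast, CharP.cast_eq_zero]
    rw [← hker, RingHom.mem_ker, map_natCast] at this
    exact this
  refine ⟨κ, hκ, (CharP.charP_iff_prime_eq_zero Fact.out).2 hp, ψ, σ, ?_, hσ⟩
  have : (X - (a : ℤ[X])) ∈ RingHom.ker φ := by
    rw [RingHom.mem_ker, map_sub, map_natCast, sub_eq_zero]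
    exact eval₂_X _ _
  rw [← hker, RingHom.mem_ker, map_sub, map_natCast, sub_eq_zero] at this
  exact this

theorem map_comp_eq_prod {L : Type} [Field L] [Algebra ℤ[X] L]
    {root : Fin 12 → integralClosure ℤ[X] L}
    (h : fPoly.map (algebraMap ℤ[X] L) = ∏ i, (X - C (root i : L)))
    {R : Type} [CommRing R] (ψ : integralClosure ℤ[X] L →+* R) :
    fPoly.map (ψ.comp (algebraMap ℤ[X] _)) = ∏ i, (X - C (ψ (root i))) := by
  have h : fPoly.map (algebraMap ℤ[X] (integralClosure ℤ[X] L)) = ∏ i, (X - C (root i)) := by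
    have hinj : Function.Injective (algebraMap (integralClosure ℤ[X] L) L) :=
      Subtype.val_injective
    refine map_injective _ hinj ?_
    rw [Polynomial.map_map, ← IsScalarTower.algebraMap_eq, h, Polynomial.map_prod]
    simp
  rw [← Polynomial.map_map, h, Polynomial.map_prod]
  simp

/-- The roots of `fPoly`, as elements of the integral closure. -/
structure Roots (L : Type) [Field L] [Algebra ℤ[X] L] where
  root : Fin 12 → integralClosure ℤ[X] L
  prod_eq : fPoly.map (algebraMap ℤ[X] L) = ∏ i, (X - C (root i : L))
  inj : Function.Injective root

namespace Roots

section

variable {L : Type} [Field L] [Algebra ℤ[X] L] (b : Roots L)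

theorem prod_eq_map {R : Type} [CommRing R] (ψ : integralClosure ℤ[X] L →+* R) :
    fPoly.map (ψ.comp (algebraMap ℤ[X] _)) = ∏ i, (X - C (ψ (b.root i))) :=
  map_comp_eq_prod b.prod_eq ψ

theorem isRoot_iff (x : L) :
    (fPoly.map (algebraMap ℤ[X] L)).eval x = 0 ↔ ∃ i, (b.root i : L) = x := by
  rw [b.prod_eq, eval_prod, Finset.prod_eq_zero_iff]
  simp [sub_eq_zero, eq_comm (a := x)]

theorem eq_of_root {i j : Fin 12} (h : (b.root i : L) = b.root j) : i = j :=
  b.inj (Subtype.ext h)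

theorem exists_hexPoly_eq_zero : ∃ S : Finset (Fin 12), S.card = 6 ∧ hexPoly 1 S b.root = 0 :=
  FB.exists_hexPoly_eq_zero (algebraMap ℤ[X] _) b.root (b.prod_eq_map (RingHom.id _))

end

variable {L : Type} [Field L] [Algebra (RatFunc ℚ) L] [Algebra ℤ[X] L]
  [IsScalarTower ℤ[X] (RatFunc ℚ) L] (b : Roots L)

theorem exists_conj (σ : Gal(L/RatFunc ℚ)) (i : Fin 12) :
    ∃ j, (b.root j : L) = σ (b.root i) := by
  rw [← b.isRoot_iff]
  have h := (b.isRoot_iff (b.root i)).2 ⟨i, rfl⟩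
  let τ : L →ₐ[ℤ[X]] L := σ.toAlgHom.restrictScalars ℤ[X]
  rw [← τ.comp_algebraMap, ← Polynomial.map_map]
  refine (eval_map_apply (f := (τ : L →+* L)) (b.root i : L)).trans ?_
  rw [h, map_zero]

/-- The permutation of the roots induced by an automorphism. -/
noncomputable def conj (σ : Gal(L/RatFunc ℚ)) (i : Fin 12) : Fin 12 := (b.exists_conj σ i).choose

theorem root_conj (σ : Gal(L/RatFunc ℚ)) (i : Fin 12) :
    (b.root (b.conj σ i) : L) = σ (b.root i) := (b.exists_conj σ i).choose_spec

/-- The permutation representation of the Galois group on the roots. -/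
noncomputable def perm : Gal(L/RatFunc ℚ) →* Equiv.Perm (Fin 12) where
  toFun σ := 
    { toFun := b.conj σ
      invFun := b.conj σ⁻¹
      left_inv i := b.eq_of_root (by rw [root_conj, root_conj, ← AlgEquiv.mul_apply]; simp)
      right_inv i := b.eq_of_root (by rw [root_conj, root_conj, ← AlgEquiv.mul_apply]; simp) }
  map_one' := Equiv.ext fun i => b.eq_of_root (by simp [root_conj])
  map_mul' σ τ := Equiv.ext fun i => b.eq_of_root (by simp [root_conj])

theorem root_perm (σ : Gal(L/RatFunc ℚ)) (i : Fin 12) :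
    (b.root (b.perm σ i) : L) = σ (b.root i) := b.root_conj σ i

theorem hexPoly_perm (σ : Gal(L/RatFunc ℚ)) {S : Finset (Fin 12)}
    (hS : hexPoly 1 S b.root = 0) : hexPoly 1 (S.map (b.perm σ).toEmbedding) b.root = 0 := by
  have h := congrArg (algebraMap (integralClosure ℤ[X] L) L) hS
  rw [map_hexPoly] at h
  have hinj : Function.Injective (algebraMap (integralClosure ℤ[X] L) L) :=
    Subtype.val_injective
  apply hinj
  rw [map_hexPoly, hexPoly_map]
  have := congrArg (σ : L →+* L) h
  rw [map_hexPoly] at this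
  simp only [map_one, map_zero] at this ⊢
  rw [← this]
  congr 1
  funext i
  exact b.root_perm σ i

end Roots

/-! ### Arithmetic of polynomials over `ZMod p`, represented by lists of natural numbers -/

/-- The value at `x` of the polynomial with list of coefficients `l`. -/
def evalList {R : Type*} [CommRing R] (x : R) (l : List ℕ) : R :=
  l.foldr (fun (c : ℕ) r => (c : R) + x * r) 0

theorem evalList_cons {R : Type*} [CommRing R] (x : R) (c : ℕ) (l : List ℕ) :
    evalList x (c :: l) = c + x * evalList x l := rfl

/-- Sum of coefficient lists modulo `p`. -/
def addList (p : ℕ) : List ℕ → List ℕ → List ℕ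
  | [], m => m
  | l, [] => l
  | a :: l, b :: m => (a + b) % p :: addList p l m

/-- Scalar multiple of a coefficient list modulo `p`. -/
def smulList (p c : ℕ) (l : List ℕ) : List ℕ := l.map fun a => c * a % p

/-- Product of coefficient lists modulo `p`. -/
def mulList (p : ℕ) (l m : List ℕ) : List ℕ :=
  l.foldr (fun a r => addList p (smulList p a m) (0 :: r)) []

/-- Replacing `x ^ 12` by the polynomial with coefficients `f`. -/
def reduceList (p : ℕ) (f l : List ℕ) : List ℕ :=
  addList p (l.take 12) (mulList p (l.drop 12) f)

/-- Composition of polynomials modulo `x ^ 12 = f`. -/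
def compList (p : ℕ) (f l m : List ℕ) : List ℕ :=
  l.foldr (fun a r => addList p [a] (m.foldr
    (fun b t => addList p (smulList p b r) (reduceList p f (0 :: t))) [])) []

/-- The coefficients of `x ^ n` modulo `x ^ 12 = f`. -/
def powList (p : ℕ) (f : List ℕ) (n : ℕ) : List ℕ :=
  Nat.rec [1] (fun _ t => reduceList p f (0 :: t)) n

/-- The coefficients of `x ^ p ^ k` modulo `x ^ 12 = f`. -/
def frobList (p : ℕ) (f : List ℕ) (k : ℕ) : List ℕ :=
  Nat.rec [0, 1] (fun _ t => compList p f t (powList p f p)) k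

/-- Difference of coefficient lists modulo `p`. -/
def subList (p : ℕ) (l m : List ℕ) : List ℕ := addList p l (smulList p (p - 1) m)

section

variable {R : Type*} [CommRing R] {p : ℕ}

theorem natCast_mod_of_eq_zero (hp : (p : R) = 0) (n : ℕ) : ((n % p : ℕ) : R) = n := by
  conv_rhs => rw [← Nat.div_add_mod n p]
  simp [hp]

theorem evalList_addList (hp : (p : R) = 0) (x : R) (l m : List ℕ) :
    evalList x (addList p l m) = evalList x l + evalList x m := by
  induction l generalizing m with
  | nil => simp [addList, evalList]
  | cons a l ih =>
    cases m with
    | nil => simp [addList, evalList]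
    | cons b m =>
      have := ih m
      simp only [addList, evalList, List.foldr_cons, natCast_mod_of_eq_zero hp] at this ⊢
      rw [this]
      push_cast
      ring

theorem evalList_smulList (hp : (p : R) = 0) (x : R) (c : ℕ) (l : List ℕ) :
    evalList x (smulList p c l) = c * evalList x l := by
  induction l with
  | nil => simp [smulList, evalList]
  | cons a l ih =>
    simp only [smulList, evalList, List.map_cons, List.foldr_cons,
      natCast_mod_of_eq_zero hp] at ih ⊢
    rw [ih]
    push_cast
    ring

theorem evalList_mulList (hp : (p : R) = 0) (x : R) (l m : List ℕ) :
    evalList x (mulList p l m) = evalList x l * evalList x m := by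
  induction l with
  | nil => simp [mulList, evalList]
  | cons a l ih =>
    have h : mulList p (a :: l) m = addList p (smulList p a m) (0 :: mulList p l m) := rfl
    rw [h, evalList_addList hp, evalList_smulList hp, evalList_cons, ih, evalList_cons]
    push_cast
    ring

theorem evalList_subList (hp : (p : R) = 0) (x : R) (hp0 : p ≠ 0) (l m : List ℕ) :
    evalList x (subList p l m) = evalList x l - evalList x m := by
  rw [subList, evalList_addList hp, evalList_smulList hp, Nat.cast_pred (by omega), hp]
  ring

theorem evalList_append (x : R) (l m : List ℕ) :
    evalList x (l ++ m) = evalList x l + x ^ l.length * evalList x m := by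
  induction l with
  | nil => simp [evalList]
  | cons a l ih =>
    rw [List.cons_append, evalList_cons, ih, evalList_cons, List.length_cons]
    ring

theorem evalList_reduceList (hp : (p : R) = 0) (x : R) {f : List ℕ}
    (hf : x ^ 12 = evalList x f) (l : List ℕ) :
    evalList x (reduceList p f l) = evalList x l := by
  rw [reduceList, evalList_addList hp, evalList_mulList hp]
  conv_rhs => rw [← List.take_append_drop 12 l, evalList_append]
  rcases le_or_gt 12 l.length with h | h
  · rw [List.length_take_of_le h, hf, mul_comm]
  · simp [List.drop_eq_nil_of_le h.le, evalList]

theorem evalList_compList (hp : (p : R) = 0) (x : R) {f : List ℕ}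
    (hf : x ^ 12 = evalList x f) (l m : List ℕ) :
    evalList x (compList p f l m) = evalList (evalList x m) l := by
  induction l with
  | nil => simp [compList, evalList]
  | cons a l ih =>
    have hm (m r : List ℕ) : evalList x (m.foldr
        (fun b t => addList p (smulList p b r) (reduceList p f (0 :: t))) []) =
          evalList x m * evalList x r := by
      induction m with
      | nil => simp [evalList]
      | cons b m ih =>
        rw [List.foldr_cons, evalList_addList hp, evalList_smulList hp,
          evalList_reduceList hp x hf, evalList_cons, ih, evalList_cons]
        push_cast
        ring
    rw [compList, List.foldr_cons, evalList_addList hp, hm, ← compList, ih, evalList_cons,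
      evalList_cons]
    simp [evalList]

theorem evalList_powList (hp : (p : R) = 0) (x : R) {f : List ℕ}
    (hf : x ^ 12 = evalList x f) (n : ℕ) :
    evalList x (powList p f n) = x ^ n := by
  induction n with
  | zero => simp [powList, evalList]
  | succ n ih =>
    have h : powList p f (n + 1) = reduceList p f (0 :: powList p f n) := rfl
    rw [h, evalList_reduceList hp x hf, evalList_cons, ih]
    push_cast
    ring

end

theorem evalList_pow {R : Type*} [CommRing R] (p : ℕ) [Fact p.Prime] [CharP R p] (x : R)
    (l : List ℕ) : evalList x l ^ p = evalList (x ^ p) l := by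
  induction l with
  | nil => simp [evalList, (Fact.out : p.Prime).ne_zero]
  | cons a l ih =>
    rw [evalList_cons, evalList_cons, add_pow_char, mul_pow, ih, ← frobenius_def, map_natCast]

theorem evalList_frobList {R : Type*} [CommRing R] {p : ℕ} [Fact p.Prime] [CharP R p] {x : R}
    {f : List ℕ} (hf : x ^ 12 = evalList x f) (k : ℕ) :
    evalList x (frobList p f k) = x ^ p ^ k := by
  have hp : (p : R) = 0 := CharP.cast_eq_zero R p
  induction k with
  | zero => simp [frobList, evalList]
  | succ k ih =>
    have h : frobList p f (k + 1) = compList p f (frobList p f k) (powList p f p) := rfl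
    rw [h, evalList_compList hp x hf, evalList_powList hp x hf, ← evalList_pow, ih, pow_succ,
      pow_mul]

theorem evalList_map {R S : Type*} [CommRing R] [CommRing S] (f : R →+* S) (x : R) (l : List ℕ) :
    f (evalList x l) = evalList (f x) l := by
  induction l with
  | nil => simp [evalList]
  | cons a l ih =>
    rw [evalList_cons, map_add, map_mul, ih, map_natCast, evalList_cons]

/-- The coefficients of `x ^ 12` modulo the specialization of `fPoly` at `s = a`. -/
def fList (p a : ℕ) : List ℕ :=
  [332150625, 1328602500, -319848750 - 1007769600 * (a : ℤ), 1131772500, 100875375, -107163000,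
    -10570500, 3645000, 888975, 83700, 4050, 100].map fun z => (-z % (p : ℤ)).toNat

theorem eval_map_fPoly_eq_zero_iff {R : Type*} [CommRing R] {p a : ℕ} (hp : (p : R) = 0)
    (hp0 : p ≠ 0) (φ : ℤ[X] →+* R) (hφ : φ X = a) (x : R) :
    (fPoly.map φ).eval x = 0 ↔ x ^ 12 = evalList x (fList p a) := by
  have h (z : ℤ) : (((-z % (p : ℤ)).toNat : ℕ) : R) = -z := by
    rw [← Int.cast_natCast, Int.toNat_of_nonneg (Int.emod_nonneg _ (by exact_mod_cast hp0)),
      Int.emod_def]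
    simp [hp]
  rw [eval_map_fPoly, hφ, ← sub_eq_zero (a := x ^ 12)]
  simp only [evalTerms, fTerms, fList, evalList, List.map_cons, List.map_nil,
    List.zipWith_cons_cons, List.zipWith_nil_left, List.prod_cons, List.prod_nil, List.sum_cons,
    List.sum_nil, List.foldr_cons, List.foldr_nil, h]
  push_cast
  refine Eq.congr_left ?_
  ring

/-- Two coefficient lists agree modulo `p`. -/
def eqList (p : ℕ) (l m : List ℕ) : Bool := (subList p l m).all (· == 0)

theorem evalList_eq_of_eqList {R : Type*} [CommRing R] {p : ℕ} (hp : (p : R) = 0) (hp0 : p ≠ 0)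
    {l m : List ℕ} (h : eqList p l m = true) (x : R) : evalList x l = evalList x m := by
  rw [← sub_eq_zero, ← evalList_subList hp x hp0]
  rw [eqList, List.all_eq_true] at h
  generalize subList p l m = t at h
  induction t with
  | nil => simp [evalList]
  | cons a t ih =>
    rw [evalList_cons, ih fun y hy => h y (List.mem_cons_of_mem _ hy)]
    simp [show a = 0 by simpa using h a]

/-- A certificate for the fact that the monic polynomial `q`, given without its leading
coefficient, is the greatest common divisor of `x ^ 12 - f` and `x ^ p ^ k - x`. -/
def fixedCheck (p : ℕ) (f : List ℕ) (k : ℕ) (q r u v w : List ℕ) : Bool :=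
  let d := subList p (frobList p f k) [0, 1]
  q.length + r.length == 12 &&
  eqList p (mulList p (q ++ [1]) (r ++ [1])) (subList p (List.replicate 12 0 ++ [1]) f) &&
  eqList p d (mulList p (q ++ [1]) u) &&
  eqList p (addList p (mulList p v d) (mulList p w (r ++ [1]))) [1]

section

variable {κ : Type} [Field κ] {p : ℕ} [Fact p.Prime] [CharP κ p]

theorem injective_roots {a : ℕ} (φ : ℤ[X] →+* κ) (hφ : φ X = a) (γ : Fin 12 → κ)
    (hγ : fPoly.map φ = ∏ i, (X - C (γ i))) {k : ℕ} (hk : k ≠ 0)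
    (h : eqList p (frobList p (fList p a) k) [0, 1] = true) : Function.Injective γ := by
  have hp0 : p ≠ 0 := (Fact.out : p.Prime).ne_zero
  rw [← separable_prod_X_sub_C_iff, ← hγ]
  refine Separable.of_dvd (galois_poly_separable p (p ^ k) (dvd_pow_self p hk)) ?_
  have hpA : (p : AdjoinRoot (fPoly.map φ)) = 0 := by
    rw [← map_natCast (AdjoinRoot.mk (fPoly.map φ)), ← map_natCast C, CharP.cast_eq_zero,
      map_zero, map_zero]
  have : Nontrivial (AdjoinRoot (fPoly.map φ)) := by
    refine AdjoinRoot.nontrivial _ ?_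
    rw [fPoly_monic.degree_map, degree_eq_natDegree fPoly_monic.ne_zero, natDegree_fPoly]
    norm_num
  have : CharP (AdjoinRoot (fPoly.map φ)) p := (CharP.charP_iff_prime_eq_zero Fact.out).2 hpA
  have hx : (AdjoinRoot.root (fPoly.map φ)) ^ 12 =
      evalList (AdjoinRoot.root (fPoly.map φ)) (fList p a) := by
    rw [← eval_map_fPoly_eq_zero_iff hpA hp0 ((AdjoinRoot.of _).comp φ) (by simp [hφ]),
      ← Polynomial.map_map, eval_map]
    exact AdjoinRoot.eval₂_root _
  have h2 := evalList_frobList hx k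
  rw [evalList_eq_of_eqList hpA hp0 h] at h2
  rw [← AdjoinRoot.mk_eq_zero, map_sub, map_pow, AdjoinRoot.mk_X, ← h2]
  simp [evalList]

theorem card_le_of_evalList_eq_zero {γ : Fin 12 → κ} (hγ : Function.Injective γ) (q : List ℕ)
    (s : Finset (Fin 12)) (hs : ∀ i ∈ s, evalList (γ i) (q ++ [1]) = 0) :
    s.card ≤ q.length := by
  classical
  have hdeg : (evalList X q : κ[X]).degree < q.length := by
    clear hs
    induction q with
    | nil => simp [evalList]
    | cons a q ih =>
      rw [evalList_cons, List.length_cons]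
      refine (degree_add_le _ _).trans_lt (max_lt ?_ ?_)
      · rw [← C_eq_natCast]
        exact degree_C_le.trans_lt (by exact_mod_cast q.length.succ_pos)
      · rw [X_mul, Nat.cast_succ]
        rcases eq_or_ne (evalList X q : κ[X]) 0 with h | h
        · rw [h, zero_mul, degree_zero]
          exact WithBot.bot_lt_coe (q.length + 1)
        · rw [degree_mul_X]
          exact WithBot.add_lt_add_right (by simp) ih
  have hq : (evalList X (q ++ [1]) : κ[X]) = X ^ q.length + evalList X q := by
    rw [evalList_append, add_comm]
    simp [evalList]
  have hmonic : (evalList X (q ++ [1]) : κ[X]).Monic := hq ▸ monic_X_pow_add hdeg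
  have hnat : (evalList X (q ++ [1]) : κ[X]).natDegree = q.length := by
    rw [hq, natDegree_add_eq_left_of_degree_lt (by simpa using hdeg), natDegree_X_pow]
  rw [← Finset.card_image_of_injective _ hγ, ← hnat]
  refine (Finset.card_le_card ?_).trans
    ((evalList X (q ++ [1]) : κ[X]).roots.toFinset_card_le.trans (card_roots' _))
  intro y hy
  obtain ⟨i, hi, rfl⟩ := Finset.mem_image.1 hy
  rw [Multiset.mem_toFinset, mem_roots hmonic.ne_zero, IsRoot, ← coe_evalRingHom,
    evalList_map, coe_evalRingHom, eval_X, hs i hi]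

theorem pow_twelve_root {a : ℕ} (φ : ℤ[X] →+* κ) (hφ : φ X = a) {γ : Fin 12 → κ}
    (hγ : fPoly.map φ = ∏ i, (X - C (γ i))) (i : Fin 12) :
    γ i ^ 12 = evalList (γ i) (fList p a) := by
  rw [← eval_map_fPoly_eq_zero_iff (CharP.cast_eq_zero κ p) (Fact.out : p.Prime).ne_zero φ hφ,
    hγ, eval_prod]
  exact Finset.prod_eq_zero (Finset.mem_univ i) (by simp)

theorem root_pow_perm {a : ℕ} (φ : ℤ[X] →+* κ) (hφ : φ X = a) {γ : Fin 12 → κ}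
    (hγ : fPoly.map φ = ∏ i, (X - C (γ i))) (π : Equiv.Perm (Fin 12))
    (hπ : ∀ i, γ (π i) = γ i ^ p) (k : ℕ) (i : Fin 12) :
    γ ((π ^ k) i) = evalList (γ i) (frobList p (fList p a) k) := by
  rw [evalList_frobList (pow_twelve_root φ hφ hγ i)]
  induction k with
  | zero => simp
  | succ k ih => rw [pow_succ', Equiv.Perm.mul_apply, hπ, ih, pow_succ, pow_mul]

theorem card_fixed {a : ℕ} (φ : ℤ[X] →+* κ) (hφ : φ X = a) {γ : Fin 12 → κ}
    (hγ : fPoly.map φ = ∏ i, (X - C (γ i))) (hinj : Function.Injective γ)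
    (π : Equiv.Perm (Fin 12)) (hπ : ∀ i, γ (π i) = γ i ^ p) {k : ℕ} {q r u v w : List ℕ}
    (h : fixedCheck p (fList p a) k q r u v w = true) :
    (Finset.univ.filter fun i => (π ^ k) i = i).card = q.length := by
  have hp0 : p ≠ 0 := (Fact.out : p.Prime).ne_zero
  have hp : (p : κ) = 0 := CharP.cast_eq_zero κ p
  simp only [fixedCheck, Bool.and_eq_true, beq_iff_eq] at h
  obtain ⟨⟨⟨hlen, h1⟩, h2⟩, h3⟩ := h
  have hroot := pow_twelve_root φ hφ hγ
  have hpow := root_pow_perm φ hφ hγ π hπ k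
  have hd (i) : evalList (γ i) (subList p (frobList p (fList p a) k) [0, 1]) =
      γ ((π ^ k) i) - γ i := by
    rw [evalList_subList hp _ hp0, hpow]
    simp [evalList]
  have h1' (i) : evalList (γ i) (q ++ [1]) * evalList (γ i) (r ++ [1]) = 0 := by
    rw [← evalList_mulList hp, evalList_eq_of_eqList hp hp0 h1, evalList_subList hp _ hp0,
      evalList_append, ← hroot]
    simp [evalList, List.replicate]
  have h2' (i) := evalList_eq_of_eqList hp hp0 h2 (γ i)
  have h3' (i) := evalList_eq_of_eqList hp hp0 h3 (γ i)
  simp only [hd, evalList_mulList hp, evalList_addList hp] at h2' h3'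
  have hiff (i) : (π ^ k) i = i ↔ evalList (γ i) (q ++ [1]) = 0 := by
    refine ⟨fun hi => ?_, fun hi => hinj ?_⟩
    · have h3 := h3' i
      rw [hi, sub_self, mul_zero, zero_add] at h3
      refine (mul_eq_zero.1 (h1' i)).resolve_right fun h0 => ?_
      rw [h0] at h3
      simp [evalList] at h3
    · have h2 := h2' i
      rwa [hi, zero_mul, sub_eq_zero] at h2
  have h4 := card_le_of_evalList_eq_zero hinj q (Finset.univ.filter fun i => (π ^ k) i = i)
    fun i hi => (hiff i).1 (Finset.mem_filter.1 hi).2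
  have h5 := card_le_of_evalList_eq_zero hinj r (Finset.univ.filter fun i => ¬(π ^ k) i = i)
    fun i hi => (mul_eq_zero.1 (h1' i)).resolve_left
      fun h0 => (Finset.mem_filter.1 hi).2 ((hiff i).2 h0)
  have h6 := Finset.card_filter_add_card_filter_not (s := Finset.univ)
    fun i => (π ^ k) i = i
  rw [Finset.card_univ, Fintype.card_fin] at h6
  omega

end

theorem Roots.exists_perm {L : Type} [Field L] [Algebra (RatFunc ℚ) L] [Algebra ℤ[X] L]
    [IsScalarTower ℤ[X] (RatFunc ℚ) L] [FiniteDimensional (RatFunc ℚ) L]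
    [IsGalois (RatFunc ℚ) L] (b : Roots L) (p a : ℕ) [Fact p.Prime] {k : ℕ} (hk : k ≠ 0)
    (h : eqList p (frobList p (fList p a) k) [0, 1] = true) :
    ∃ π ∈ b.perm.range, π ^ k = 1 ∧ ∀ k q r u v w,
      fixedCheck p (fList p a) k q r u v w = true →
        (Finset.univ.filter fun i => (π ^ k) i = i).card = q.length := by
  obtain ⟨κ, _, _, ψ, σ, hψ, hσ⟩ := exists_frobenius_at L p a
  have hφ : (ψ.comp (algebraMap ℤ[X] _)) X = a := hψ
  have hinj := injective_roots _ hφ _ (b.prod_eq_map ψ) hk h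
  have hπ (i) : ψ (b.root (b.perm σ i)) = ψ (b.root i) ^ p := hσ _ _ (b.root_perm σ i)
  refine ⟨b.perm σ, ⟨σ, rfl⟩, ?_, fun k q r u v w hc =>
    card_fixed _ hφ (b.prod_eq_map ψ) hinj _ hπ hc⟩
  refine Equiv.ext fun i => hinj ?_
  refine (root_pow_perm _ hφ (b.prod_eq_map ψ) _ hπ k i).trans ?_
  rw [evalList_eq_of_eqList (CharP.cast_eq_zero κ p) (Fact.out : p.Prime).ne_zero h]
  simp [evalList]

section

variable {L : Type} [Field L] [Algebra (RatFunc ℚ) L] [Algebra ℤ[X] L]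
  [IsScalarTower ℤ[X] (RatFunc ℚ) L] [FiniteDimensional (RatFunc ℚ) L]
  [IsGalois (RatFunc ℚ) L] (b : Roots L)

theorem Roots.exists_perm_pow_eleven : ∃ π ∈ b.perm.range, π ^ 11 = 1 ∧
      (Finset.univ.filter fun i => π i = i).card = 1 := by
  have : Fact (Nat.Prime 7) := ⟨by norm_num⟩
  obtain ⟨π, hπ, h, hc⟩ := b.exists_perm 7 1 (k := 11) (by norm_num) (by decide +kernel)
  refine ⟨π, hπ, h,
    hc 1 [1] [2, 6, 6, 6, 0, 0, 4, 5, 5, 3, 1]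
      [0, 6, 1, 6, 1, 6, 1]
      [2, 0, 3, 5, 4, 6, 2, 6, 6, 6, 5]
      [4, 3, 0, 5, 3, 6, 2] (by decide +kernel)⟩

theorem Roots.exists_perm_pow_ten : ∃ π ∈ b.perm.range, π ^ 10 = 1 ∧
      (Finset.univ.filter fun i => (π ^ 2) i = i).card = 2 ∧
      (Finset.univ.filter fun i => (π ^ 5) i = i).card = 0 := by
  have : Fact (Nat.Prime 11) := ⟨by norm_num⟩
  obtain ⟨π, hπ, h, hc⟩ := b.exists_perm 11 5 (k := 10) (by norm_num) (by decide +kernel)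
  refine ⟨π, hπ, h,
    hc 2 [1, 10] [4, 9, 5, 8, 10, 3, 9, 2, 3, 2]
      [6, 9, 6, 1, 8, 7, 5, 6, 8, 2]
      [7, 2, 5, 6, 6, 7, 5, 10, 9, 6]
      [9, 10, 7, 4, 5, 6, 9, 2, 0, 3, 10] (by decide +kernel),
    hc 5 [] [4, 5, 0, 1, 7, 1, 5, 7, 10, 1, 2, 1]
      [9, 0, 2, 5, 8, 7, 0, 8, 7, 7, 9, 6]
      [6, 7, 9, 4, 5, 9, 4, 3, 10, 9, 9, 9]
      [6, 7, 1, 2, 1, 1, 1, 2, 2, 7, 1] (by decide +kernel)⟩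

theorem Roots.exists_perm_pow_eight : ∃ π ∈ b.perm.range, π ^ 8 = 1 ∧
      (Finset.univ.filter fun i => π i = i).card = 2 ∧
      (Finset.univ.filter fun i => (π ^ 2) i = i).card = 4 ∧
      (Finset.univ.filter fun i => (π ^ 4) i = i).card = 4 := by
  have : Fact (Nat.Prime 7) := ⟨by norm_num⟩
  obtain ⟨π, hπ, h, hc⟩ := b.exists_perm 7 4 (k := 8) (by norm_num) (by decide +kernel)
  refine ⟨π, hπ, h,
    hc 1 [5, 1] [6, 6, 4, 6, 2, 4, 1, 5, 5, 1]
      [0, 4, 2, 3, 6, 1]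
      [4, 1, 2, 2, 0, 2, 2, 6, 0, 2]
      [6, 4, 5, 3, 2, 2, 5] (by decide +kernel),
    hc 2 [5, 1, 6, 1] [6, 6, 5, 0, 4, 4, 4, 1]
      [2, 3, 4, 6, 2, 6, 4, 1]
      [6, 5, 0, 2, 0, 4, 3]
      [3, 2, 0, 4, 1, 5, 0, 2, 5, 4] (by decide +kernel),
    hc 4 [5, 1, 6, 1] [6, 6, 5, 0, 4, 4, 4, 1]
      [1, 0, 6, 0, 6, 3, 0, 5]
      [0, 0, 5, 3, 5, 3, 4, 2]
      [6, 1, 5, 6, 6, 5, 2, 3, 1, 1, 4] (by decide +kernel)⟩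

theorem Roots.exists_perm_pow_six : ∃ π ∈ b.perm.range, π ^ 6 = 1 ∧
      (Finset.univ.filter fun i => (π ^ 2) i = i).card = 3 ∧
      (Finset.univ.filter fun i => (π ^ 3) i = i).card = 4 := by
  have : Fact (Nat.Prime 7) := ⟨by norm_num⟩
  obtain ⟨π, hπ, h, hc⟩ := b.exists_perm 7 3 (k := 6) (by norm_num) (by decide +kernel)
  refine ⟨π, hπ, h,
    hc 2 [2, 4, 4] [1, 2, 2, 1, 3, 5, 3, 1, 5]
      [2, 6, 4, 4, 3, 3, 5, 3, 1]
      [0, 4, 6, 3, 3, 1, 5, 0, 3]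
      [1, 3, 0, 2, 3, 2, 0, 1, 0, 1, 4] (by decide +kernel),
    hc 3 [2, 4, 3, 3] [1, 2, 6, 0, 1, 2, 4, 6]
      [5, 6, 5, 4, 5, 2, 6, 2]
      [0, 0, 4, 2, 1, 6, 0, 3]
      [1, 5, 0, 4, 1, 2, 1, 6, 4, 0, 1] (by decide +kernel)⟩

end

end FB

namespace FB

open Equiv

section Counting

variable {α : Type*} [DecidableEq α]

/-- An invariant set and the set of fixed points in it of a permutation of order a power of `p`
have the same cardinality modulo `p`. -/
theorem card_modEq_card_fixed (g : Perm α) (p n : ℕ) [Fact p.Prime] (hg : g ^ p ^ n = 1)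
    (s : Finset α) (hs : ∀ x ∈ s, g x ∈ s) :
    s.card ≡ (s.filter fun x => g x = x).card [MOD p] := by
  let f : Function.End s := fun x => ⟨g x, hs x x.2⟩
  have hf (k : ℕ) (x : s) : ((f ^ k) x : α) = (g ^ k) x := by
    induction k generalizing x with
    | zero => rfl
    | succ k ih => exact ih (f x)
  have h := Perm.card_fixedPoints_modEq (f := f) (p := p) (n := n)
    (funext fun x => Subtype.ext ((hf _ x).trans (by rw [hg]; rfl)))
  rw [Fintype.card_coe] at h
  refine h.trans (congrArg (· % p) ?_)
  rw [← Fintype.card_coe (s.filter fun x => g x = x)]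
  refine Fintype.card_congr
    { toFun x := ⟨x.1, Finset.mem_filter.2 ⟨x.1.2, congrArg Subtype.val x.2⟩⟩
      invFun x := ⟨⟨x.1, (Finset.mem_filter.1 x.2).1⟩,
        Subtype.ext (Finset.mem_filter.1 x.2).2⟩
      left_inv _ := rfl
      right_inv _ := rfl }

theorem dvd_card_of_forall_ne (g : Perm α) (p n : ℕ) [Fact p.Prime] (hg : g ^ p ^ n = 1)
    (s : Finset α) (hs : ∀ x ∈ s, g x ∈ s) (hne : ∀ x ∈ s, g x ≠ x) : p ∣ s.card := by
  have h := card_modEq_card_fixed g p n hg s hs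
  rwa [Finset.filter_false_of_mem hne, Finset.card_empty, Nat.modEq_zero_iff_dvd] at h

theorem four_dvd_card (g : Perm α) (hg : g ^ 4 = 1) (s : Finset α) (hs : ∀ x ∈ s, g x ∈ s)
    (hne : ∀ x ∈ s, (g ^ 2) x ≠ x) : 4 ∣ s.card := by
  have h4 (x) : g (g (g (g x))) = x := congrArg (fun h : Perm α => h x) hg
  induction s using Finset.strongInduction with
  | H s ih =>
    rcases s.eq_empty_or_nonempty with rfl | ⟨x, hx⟩
    · simp
    have hxx : g (g x) ≠ x := hne x hx
    have hx1 : g x ≠ x := fun h => hxx (by rw [h, h])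
    let t : Finset α := {x, g x, g (g x), g (g (g x))}
    have hts : t ⊆ s := by
      simp only [t, Finset.insert_subset_iff, Finset.singleton_subset_iff]
      exact ⟨hx, hs _ hx, hs _ (hs _ hx), hs _ (hs _ (hs _ hx))⟩
    have ht : t.card = 4 := by
      have h3 : g (g (g x)) ≠ x := fun h => hx1 (by simpa only [h] using h4 x)
      simp [t, Finset.card_insert_of_notMem, hx1.symm, hxx.symm, h3.symm]
    have htg (y) (hy : g y ∈ t) : y ∈ t := by
      simp only [t, Finset.mem_insert, Finset.mem_singleton, EmbeddingLike.apply_eq_iff_eq] at hy ⊢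
      rcases hy with h | h | h | h
      · exact Or.inr (Or.inr (Or.inr (g.injective (by rw [h, h4]))))
      all_goals simp [h]
    have := ih (s \ t) (Finset.sdiff_ssubset hts ⟨x, by simp [t]⟩)
      (fun y hy => by
        rw [Finset.mem_sdiff] at hy ⊢
        exact ⟨hs y hy.1, fun h => hy.2 (htg y h)⟩)
      fun y hy => hne y (Finset.mem_sdiff.1 hy).1
    rw [← Finset.card_sdiff_add_card_eq_card hts, ht]
    omega

end Counting

section Rel

variable {α : Type*} (Γ : Subgroup (Perm α))

/-- Two points are in the same orbit under the pointwise stabilizer of `s`. -/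
def FixRel (s : Finset α) (a b : α) : Prop := ∃ γ ∈ Γ, (∀ i ∈ s, γ i = i) ∧ γ a = b

variable {Γ} {s : Finset α} {a b c : α}

theorem FixRel.refl (s : Finset α) (a : α) : FixRel Γ s a a := ⟨1, Γ.one_mem, by simp, rfl⟩

theorem FixRel.symm (h : FixRel Γ s a b) : FixRel Γ s b a := by
  obtain ⟨γ, hγ, hs, rfl⟩ := h
  exact ⟨γ⁻¹, Γ.inv_mem hγ, fun i hi => by rw [Perm.inv_eq_iff_eq, hs i hi], by simp⟩

theorem FixRel.trans (h : FixRel Γ s a b) (h' : FixRel Γ s b c) : FixRel Γ s a c := by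
  obtain ⟨γ, hγ, hs, rfl⟩ := h
  obtain ⟨δ, hδ, hs', rfl⟩ := h'
  exact ⟨δ * γ, Γ.mul_mem hδ hγ, fun i hi => by rw [Perm.mul_apply, hs i hi, hs' i hi], rfl⟩

theorem FixRel.map {δ : Perm α} (hδ : δ ∈ Γ) (h : FixRel Γ s a b) :
    FixRel Γ (s.map δ.toEmbedding) (δ a) (δ b) := by
  obtain ⟨γ, hγ, hs, rfl⟩ := h
  refine ⟨δ * γ * δ⁻¹, Γ.mul_mem (Γ.mul_mem hδ hγ) (Γ.inv_mem hδ), fun i hi => ?_, by simp⟩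
  obtain ⟨j, hj, rfl⟩ := Finset.mem_map.1 hi
  simp [hs j hj]

theorem map_inv_map (δ : Perm α) (s : Finset α) :
    (s.map δ.toEmbedding).map (δ⁻¹ : Perm α).toEmbedding = s := by
  rw [Finset.map_map]
  convert Finset.map_refl
  ext x
  simp

theorem fixRel_map_iff {δ : Perm α} (hδ : δ ∈ Γ) :
    FixRel Γ (s.map δ.toEmbedding) (δ a) (δ b) ↔ FixRel Γ s a b := by
  refine ⟨fun h => ?_, FixRel.map hδ⟩
  have := h.map (Γ.inv_mem hδ)
  rw [map_inv_map] at this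
  simpa using this

variable [Fintype α]

open scoped Classical in
variable (Γ) in
/-- The orbit of `a` under the pointwise stabilizer of `s`. -/
noncomputable def fixOrbit (s : Finset α) (a : α) : Finset α :=
  Finset.univ.filter (FixRel Γ s a)

theorem mem_fixOrbit : b ∈ fixOrbit Γ s a ↔ FixRel Γ s a b := by simp [fixOrbit]

theorem notMem_of_mem_fixOrbit (ha : a ∉ s) (h : b ∈ fixOrbit Γ s a) : b ∉ s := by
  obtain ⟨γ, hγ, hs, rfl⟩ := mem_fixOrbit.1 h
  exact fun h => ha (by rwa [γ.injective (hs _ h)] at h)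

theorem apply_mem_fixOrbit {g : Perm α} (hg : g ∈ Γ) (hs : ∀ i ∈ s, g i = i)
    (h : b ∈ fixOrbit Γ s a) : g b ∈ fixOrbit Γ s a :=
  mem_fixOrbit.2 ((mem_fixOrbit.1 h).trans ⟨g, hg, hs, rfl⟩)

theorem card_fixOrbit_pos : 0 < (fixOrbit Γ s a).card :=
  Finset.card_pos.2 ⟨a, mem_fixOrbit.2 (.refl s a)⟩

theorem card_fixOrbit_map {δ : Perm α} (hδ : δ ∈ Γ) :
    (fixOrbit Γ (s.map δ.toEmbedding) (δ a)).card = (fixOrbit Γ s a).card := by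
  refine Eq.trans (congrArg _ ?_) (Finset.card_map δ.toEmbedding)
  ext b
  obtain ⟨b, rfl⟩ := δ.surjective b
  rw [mem_fixOrbit, fixRel_map_iff hδ, ← mem_fixOrbit]
  exact (Finset.mem_map' δ.toEmbedding).symm

variable (Γ) in
/-- All orbits of the pointwise stabilizer of `s` outside `s` have size divisible by `n`. -/
def DvdOrbits (n : ℕ) (s : Finset α) : Prop := ∀ a ∉ s, n ∣ (fixOrbit Γ s a).card

/-- The group acts transitively on the set of `k`-element subsets. -/
def Homogeneous (α : Type*) (Γ : Subgroup (Perm α)) (k : ℕ) : Prop :=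
  ∀ s t : Finset α, s.card = k → t.card = k → ∃ γ ∈ Γ, s.map γ.toEmbedding = t

theorem DvdOrbits.of_homogeneous {n : ℕ} {t : Finset α} (hΓ : Homogeneous α Γ s.card)
    (h : DvdOrbits Γ n s) (ht : t.card = s.card) : DvdOrbits Γ n t := by
  obtain ⟨γ, hγ, rfl⟩ := hΓ s t rfl ht
  intro a ha
  obtain ⟨a, rfl⟩ := γ.surjective a
  rw [card_fixOrbit_map hγ]
  refine h a fun has => ha ?_
  exact Finset.mem_map.2 ⟨a, has, rfl⟩

variable [DecidableEq α]

theorem fixOrbit_subset_compl (ha : a ∉ s) : fixOrbit Γ s a ⊆ sᶜ :=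
  fun _ hb => Finset.mem_compl.2 (notMem_of_mem_fixOrbit ha hb)

theorem card_fixOrbit_le (ha : a ∉ s) : (fixOrbit Γ s a).card ≤ Fintype.card α - s.card :=
  (Finset.card_le_card (fixOrbit_subset_compl ha)).trans_eq (Finset.card_compl s)

theorem fixRel_of_dvdOrbits (h : DvdOrbits Γ (Fintype.card α - s.card) s) (ha : a ∉ s)
    (hb : b ∉ s) : FixRel Γ s a b := by
  rw [← mem_fixOrbit, Finset.eq_of_subset_of_card_le (fixOrbit_subset_compl (Γ := Γ) ha),
    Finset.mem_compl]
  · exact hb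
  · rw [Finset.card_compl]
    exact Nat.le_of_dvd card_fixOrbit_pos (h a ha)

theorem Homogeneous.succ {k : ℕ} (hΓ : Homogeneous α Γ k)
    (h : ∃ s : Finset α, s.card = k ∧ DvdOrbits Γ (Fintype.card α - k) s) :
    Homogeneous α Γ (k + 1) := by
  obtain ⟨s₀, rfl, h⟩ := h
  intro s t hs ht
  obtain ⟨a, s, ha, rfl, hs'⟩ := Finset.card_eq_succ.1 hs
  obtain ⟨b, t, hb, rfl, ht'⟩ := Finset.card_eq_succ.1 ht
  obtain ⟨γ, hγ, rfl⟩ := hΓ s t hs' ht'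
  have ha' : γ a ∉ s.map γ.toEmbedding := fun h => ha (by simpa using h)
  obtain ⟨δ, hδ, hδs, hab⟩ := fixRel_of_dvdOrbits
    (by rw [ht']; exact h.of_homogeneous hΓ ht') ha' hb
  refine ⟨δ * γ, Γ.mul_mem hδ hγ, ?_⟩
  rw [Finset.map_insert]
  refine congrArg₂ _ hab ?_
  rw [Finset.map_eq_image, Finset.map_eq_image]
  exact Finset.image_congr fun i hi => hδs _ (Finset.mem_map_of_mem _ hi)

end Rel

section

variable {Γ : Subgroup (Perm (Fin 12))}

/-- The set of fixed points of a permutation. -/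
def fixedSet (g : Perm (Fin 12)) : Finset (Fin 12) := Finset.univ.filter fun i => g i = i

theorem mem_fixedSet {g : Perm (Fin 12)} {i : Fin 12} : i ∈ fixedSet g ↔ g i = i := by
  simp [fixedSet]

theorem dvdOrbits_of_fixedSet {g : Perm (Fin 12)} (hg : g ∈ Γ) (p n : ℕ) [Fact p.Prime]
    (h : g ^ p ^ n = 1) : DvdOrbits Γ p (fixedSet g) := fun _ ha =>
  dvd_card_of_forall_ne g p n h _
    (fun _ => apply_mem_fixOrbit hg fun _ hi => mem_fixedSet.1 hi)
    fun _ hx hgx => notMem_of_mem_fixOrbit ha hx (mem_fixedSet.2 hgx)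

theorem Homogeneous.zero : Homogeneous (Fin 12) Γ 0 := fun s t hs ht =>
  ⟨1, Γ.one_mem, by rw [Finset.card_eq_zero] at hs ht; simp [hs, ht]⟩

theorem dvdOrbits_empty {c t : Perm (Fin 12)} (hc : c ∈ Γ) (hc' : c ^ 11 = 1)
    (hc1 : (fixedSet c).card = 1) (ht : t ∈ Γ) (ht' : t ^ 10 = 1)
    (ht5 : (fixedSet (t ^ 5)).card = 0) : DvdOrbits Γ 12 ∅ := by
  have : Fact (Nat.Prime 11) := ⟨by norm_num⟩
  intro a ha
  have h2 := dvdOrbits_of_fixedSet (Γ.pow_mem ht 5) 2 1 (by rw [← pow_mul]; exact ht') a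
    (by rw [Finset.card_eq_zero.1 ht5]; exact ha)
  rw [Finset.card_eq_zero.1 ht5] at h2
  have h11 := card_modEq_card_fixed c 11 1 (by rw [pow_one]; exact hc') (fixOrbit Γ ∅ a)
    fun _ => apply_mem_fixOrbit hc (by simp)
  have hle : ((fixOrbit Γ ∅ a).filter fun x => c x = x).card ≤ 1 := by
    rw [← hc1]
    exact Finset.card_le_card (Finset.filter_subset_filter _ (Finset.subset_univ _))
  have hpos := card_fixOrbit_pos (Γ := Γ) (s := ∅) (a := a)
  have h12 := card_fixOrbit_le (Γ := Γ) ha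
  simp only [Fintype.card_fin, Finset.card_empty] at h12
  rw [Nat.ModEq] at h11
  generalize (fixOrbit Γ ∅ a).card = n at *
  interval_cases n <;> omega

theorem DvdOrbits.mul {m n : ℕ} {s : Finset (Fin 12)} (h : Nat.Coprime m n)
    (hm : DvdOrbits Γ m s) (hn : DvdOrbits Γ n s) : DvdOrbits Γ (m * n) s := fun a ha =>
  h.mul_dvd_of_dvd_of_dvd (hm a ha) (hn a ha)

variable {g : Perm (Fin 12)}

theorem pow_four_apply_ne (hg2 : (fixedSet (g ^ 2)).card = 4) (hg4 : (fixedSet (g ^ 4)).card = 4)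
    {x : Fin 12} (hx : (g ^ 2) x ≠ x) : ((g ^ 2) ^ 2) x ≠ x := by
  have h : fixedSet (g ^ 2) = fixedSet (g ^ 4) := by
    refine Finset.eq_of_subset_of_card_le (fun i hi => ?_) (by rw [hg2, hg4])
    rw [mem_fixedSet] at hi ⊢
    rw [show 4 = 2 + 2 from rfl, pow_add, Perm.mul_apply, hi, hi]
  rw [← pow_mul]
  intro h4
  exact hx (mem_fixedSet.1 (h ▸ mem_fixedSet.2 h4))

theorem dvdOrbits_four (hg : g ∈ Γ) (hg' : g ^ 8 = 1)
    (hg2 : (fixedSet (g ^ 2)).card = 4) (hg4 : (fixedSet (g ^ 4)).card = 4) :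
    DvdOrbits Γ 4 (fixedSet (g ^ 2)) := fun a ha =>
  four_dvd_card (g ^ 2) (by rw [← pow_mul]; exact hg') _
    (fun _ => apply_mem_fixOrbit (Γ.pow_mem hg 2) fun _ hi => mem_fixedSet.1 hi)
    fun x hx => pow_four_apply_ne hg2 hg4 fun h =>
      notMem_of_mem_fixOrbit ha hx (mem_fixedSet.2 h)

theorem dvdOrbits_nine (hg : g ∈ Γ) (hg' : g ^ 8 = 1)
    (hg2 : (fixedSet (g ^ 2)).card = 4) (hg4 : (fixedSet (g ^ 4)).card = 4)
    (hΓ : Homogeneous (Fin 12) Γ 3) {v : Perm (Fin 12)} (hv : v ∈ Γ)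
    (hv' : v ^ 3 = 1) (hv3 : (fixedSet v).card = 3) :
    ∃ s : Finset (Fin 12), s.card = 3 ∧ DvdOrbits Γ 9 s := by
  have h3 := dvdOrbits_of_fixedSet hv 3 1 (by rw [pow_one]; exact hv')
  obtain ⟨b, s, hb, hs, hs3⟩ := Finset.card_eq_succ.1 hg2
  have h3s := DvdOrbits.of_homogeneous (hv3.symm ▸ hΓ) h3 (hs3.trans hv3.symm)
  have hfix (i) (hi : i ∈ s) : (g ^ 2) i = i :=
    mem_fixedSet.1 (hs ▸ Finset.mem_insert_of_mem hi)
  have hinv (x) (hx : x ∈ fixOrbit Γ s b) : (g ^ 2) x ∈ fixOrbit Γ s b :=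
    apply_mem_fixOrbit (Γ.pow_mem hg 2) hfix hx
  have hbfix : (g ^ 2) b = b := mem_fixedSet.1 (hs ▸ Finset.mem_insert_self _ _)
  have h4 : 4 ∣ ((fixOrbit Γ s b).erase b).card := by
    refine four_dvd_card (g ^ 2) (by rw [← pow_mul]; exact hg') _ (fun x hx => ?_) fun x hx =>
      pow_four_apply_ne hg2 hg4 fun h => ?_
    · rw [Finset.mem_erase] at hx ⊢
      exact ⟨fun h => hx.1 ((g ^ 2).injective (h.trans hbfix.symm)), hinv x hx.2⟩
    · rw [Finset.mem_erase] at hx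
      have := mem_fixedSet.2 h
      rw [← hs, Finset.mem_insert] at this
      exact this.elim hx.1 (notMem_of_mem_fixOrbit hb hx.2)
  rw [Finset.card_erase_of_mem (mem_fixOrbit.2 (.refl s b))] at h4
  have hpos := card_fixOrbit_pos (Γ := Γ) (s := s) (a := b)
  have hle := card_fixOrbit_le (Γ := Γ) hb
  rw [Fintype.card_fin, hs3] at hle
  have h3b := h3s b hb
  have h9 : (fixOrbit Γ s b).card = 9 := by omega
  refine ⟨s, hs3, fun a ha => ?_⟩
  have hab : FixRel Γ s b a := by
    rw [← mem_fixOrbit, Finset.eq_of_subset_of_card_le (fixOrbit_subset_compl (Γ := Γ) hb)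
      (by rw [Finset.card_compl, Fintype.card_fin, hs3, h9])]
    exact Finset.mem_compl.2 ha
  have : fixOrbit Γ s a = fixOrbit Γ s b := by
    ext x
    rw [mem_fixOrbit, mem_fixOrbit]
    exact ⟨hab.trans, hab.symm.trans⟩
  rw [this, h9]

theorem dvdOrbits_eight (hg : g ∈ Γ) (hg' : g ^ 8 = 1)
    (hg2 : (fixedSet (g ^ 2)).card = 4) (hg4 : (fixedSet (g ^ 4)).card = 4)
    (hΓ : Homogeneous (Fin 12) Γ 4) {u : Perm (Fin 12)} (hu : u ∈ Γ)
    (hu' : u ^ 6 = 1) (hu2 : (fixedSet (u ^ 2)).card = 3)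
    (hu3 : (fixedSet (u ^ 3)).card = 4) : DvdOrbits Γ 8 (fixedSet (u ^ 3)) := by
  have h4 : DvdOrbits Γ 4 (fixedSet (u ^ 3)) :=
    DvdOrbits.of_homogeneous (hg2.symm ▸ hΓ) (dvdOrbits_four hg hg' hg2 hg4) (hu3.trans hg2.symm)
  set S := fixedSet (u ^ 3) with hSdef
  have hS : S.map u.toEmbedding = S := by
    refine Finset.eq_of_subset_of_card_le (fun i hi => ?_) (by rw [Finset.card_map])
    obtain ⟨j, hj, rfl⟩ := Finset.mem_map.1 hi
    exact mem_fixedSet.2 (congrArg u (mem_fixedSet.1 hj))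
  have hiff {x y : Fin 12} : FixRel Γ S (u x) (u y) ↔ FixRel Γ S x y := by
    have := fixRel_map_iff (s := S) (a := x) (b := y) hu
    rwa [hS] at this
  have h3 (x : Fin 12) : FixRel Γ S x (u (u (u x))) :=
    ⟨u ^ 3, Γ.pow_mem hu 3, fun i hi => mem_fixedSet.1 hi, rfl⟩
  have hmem {x : Fin 12} (hx : x ∉ S) : u x ∉ S := fun h => hx <| by
    rw [← hS] at h
    simpa using h
  have hrel {x : Fin 12} (hx : x ∉ S) : FixRel Γ S x (u x) := by
    by_contra h
    have h1 : Disjoint (fixOrbit Γ S x) (fixOrbit Γ S (u x)) :=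
      Finset.disjoint_left.2 fun y hy hy' =>
        h ((mem_fixOrbit.1 hy).trans (mem_fixOrbit.1 hy').symm)
    have h2 : Disjoint (fixOrbit Γ S x ∪ fixOrbit Γ S (u x)) (fixOrbit Γ S (u (u x))) := by
      refine Finset.disjoint_left.2 fun y hy hy' => ?_
      rcases Finset.mem_union.1 hy with hy | hy
      · have := (mem_fixOrbit.1 hy).trans (mem_fixOrbit.1 hy').symm
        exact h ((h3 x).trans (hiff.2 this).symm)
      · exact h (hiff.1 ((mem_fixOrbit.1 hy).trans (mem_fixOrbit.1 hy').symm))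
    have hle := Finset.card_le_card (Finset.union_subset (Finset.union_subset
      (fixOrbit_subset_compl (Γ := Γ) hx) (fixOrbit_subset_compl (Γ := Γ) (hmem hx)))
        (fixOrbit_subset_compl (Γ := Γ) (hmem (hmem hx))))
    rw [Finset.card_union_of_disjoint h2, Finset.card_union_of_disjoint h1, Finset.card_compl,
      Fintype.card_fin, hu3] at hle
    have := Nat.le_of_dvd card_fixOrbit_pos (h4 x hx)
    have := Nat.le_of_dvd card_fixOrbit_pos (h4 _ (hmem hx))
    have := Nat.le_of_dvd card_fixOrbit_pos (h4 _ (hmem (hmem hx)))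
    omega
  intro a ha
  have hinv (x) (hx : x ∈ fixOrbit Γ S a) : u x ∈ fixOrbit Γ S a :=
    mem_fixOrbit.2 ((mem_fixOrbit.1 hx).trans (hrel (notMem_of_mem_fixOrbit ha hx)))
  have hmod := card_modEq_card_fixed (u ^ 2) 3 1 (by rw [← pow_mul]; exact hu')
    (fixOrbit Γ S a) fun x hx => hinv _ (hinv _ hx)
  have heven := dvd_card_of_forall_ne (u ^ 3) 2 1 (by rw [← pow_mul]; exact hu')
    ((fixOrbit Γ S a).filter fun x => (u ^ 2) x = x)
    (fun x hx => by
      rw [Finset.mem_filter] at hx ⊢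
      refine ⟨hinv _ (hinv _ (hinv _ hx.1)), ?_⟩
      have := congrArg (⇑(u ^ 3)) hx.2
      rwa [← Perm.mul_apply, ← pow_add, add_comm, pow_add, Perm.mul_apply] at this)
    fun x hx h => notMem_of_mem_fixOrbit ha (Finset.mem_filter.1 hx).1 (mem_fixedSet.2 h)
  have hle : ((fixOrbit Γ S a).filter fun x => (u ^ 2) x = x).card ≤ 3 := by
    rw [← hu2]
    exact Finset.card_le_card (Finset.filter_subset_filter _ (Finset.subset_univ _))
  have hle8 := card_fixOrbit_le (Γ := Γ) ha
  rw [Fintype.card_fin, hu3] at hle8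
  have hpos := card_fixOrbit_pos (Γ := Γ) (s := S) (a := a)
  have h4a := h4 a ha
  rw [Nat.ModEq] at hmod
  generalize (fixOrbit Γ S a).card = n at *
  interval_cases n <;> omega

theorem dvdOrbits_of_fixedSets (hg : g ∈ Γ) (hg' : g ^ 8 = 1)
    (hg2 : (fixedSet (g ^ 2)).card = 4) (hg4 : (fixedSet (g ^ 4)).card = 4)
    {c t u : Perm (Fin 12)} (hc : c ∈ Γ) (hc' : c ^ 11 = 1)
    (hc1 : (fixedSet c).card = 1) (ht : t ∈ Γ) (ht' : t ^ 10 = 1)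
    (ht2 : (fixedSet (t ^ 2)).card = 2) (ht5 : (fixedSet (t ^ 5)).card = 0)
    (hg1 : (fixedSet g).card = 2) (hu : u ∈ Γ)
    (hu' : u ^ 6 = 1) (hu2 : (fixedSet (u ^ 2)).card = 3) (hu3 : (fixedSet (u ^ 3)).card = 4)
    (k : ℕ) (hk : k < 5) : Homogeneous (Fin 12) Γ k ∧
      ∃ s : Finset (Fin 12), s.card = k ∧ DvdOrbits Γ (12 - k) s := by
  have : Fact (Nat.Prime 11) := ⟨by norm_num⟩
  have : Fact (Nat.Prime 5) := ⟨by norm_num⟩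
  have h0 := Homogeneous.zero (Γ := Γ)
  have d0 : ∃ s : Finset (Fin 12), s.card = 0 ∧ DvdOrbits Γ (12 - 0) s :=
    ⟨∅, rfl, dvdOrbits_empty hc hc' hc1 ht ht' ht5⟩
  have h1 : Homogeneous (Fin 12) Γ 1 := h0.succ d0
  have d1 : ∃ s : Finset (Fin 12), s.card = 1 ∧ DvdOrbits Γ (12 - 1) s :=
    ⟨_, hc1, dvdOrbits_of_fixedSet hc 11 1 (by rw [pow_one]; exact hc')⟩
  have h2 : Homogeneous (Fin 12) Γ 2 := h1.succ d1
  have d2 : ∃ s : Finset (Fin 12), s.card = 2 ∧ DvdOrbits Γ (12 - 2) s := by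
    refine ⟨_, ht2, DvdOrbits.mul (m := 2) (n := 5) (by norm_num) ?_
      (dvdOrbits_of_fixedSet (Γ.pow_mem ht 2) 5 1 (by rw [← pow_mul]; exact ht'))⟩
    exact DvdOrbits.of_homogeneous (hg1.symm ▸ h2) (dvdOrbits_of_fixedSet hg 2 3 hg')
      (ht2.trans hg1.symm)
  have h3 : Homogeneous (Fin 12) Γ 3 := h2.succ d2
  have d3 : ∃ s : Finset (Fin 12), s.card = 3 ∧ DvdOrbits Γ (12 - 3) s :=
    dvdOrbits_nine hg hg' hg2 hg4 h3 (Γ.pow_mem hu 2) (by rw [← pow_mul]; exact hu') hu2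
  have h4 : Homogeneous (Fin 12) Γ 4 := h3.succ d3
  have d4 : ∃ s : Finset (Fin 12), s.card = 4 ∧ DvdOrbits Γ (12 - 4) s :=
    ⟨_, hu3, dvdOrbits_eight hg hg' hg2 hg4 h4 hu hu' hu2 hu3⟩
  interval_cases k
  exacts [⟨h0, d0⟩, ⟨h1, d1⟩, ⟨h2, d2⟩, ⟨h3, d3⟩, ⟨h4, d4⟩]

end

section

variable {Γ : Subgroup (Perm (Fin 12))}

/-- If the stabilizer of every set `s` of `k < 5` points is transitive on the complement of `s`,
then the group is transitive on sequences of five distinct points. -/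
theorem exists_forall_apply_eq (h : ∀ k < 5, Homogeneous (Fin 12) Γ k ∧
    ∃ s : Finset (Fin 12), s.card = k ∧ DvdOrbits Γ (12 - k) s) (k : ℕ) (hk : k ≤ 5)
    (x y : Fin k ↪ Fin 12) : ∃ γ ∈ Γ, ∀ i, γ (x i) = y i := by
  induction k with
  | zero => exact ⟨1, Γ.one_mem, fun i => i.elim0⟩
  | succ k ih =>
    let e : Fin k ↪ Fin (k + 1) := Fin.castSuccEmb
    obtain ⟨γ, hγ, hxy⟩ := ih (by omega) (e.trans x) (e.trans y)
    obtain ⟨hom, t, ht, hd⟩ := h k (by omega)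
    let s : Finset (Fin 12) := Finset.univ.map (e.trans y)
    have hs : s.card = k := by simp [s]
    have hd' : DvdOrbits Γ (Fintype.card (Fin 12) - s.card) s := by
      rw [hs, Fintype.card_fin]
      exact hd.of_homogeneous (ht.symm ▸ hom) (hs.trans ht.symm)
    obtain ⟨δ, hδ, hδs, hab⟩ := fixRel_of_dvdOrbits hd' (a := γ (x (Fin.last k)))
      (b := y (Fin.last k))
      (fun hm => by
        obtain ⟨i, -, hi⟩ := Finset.mem_map.1 hm
        rw [← hxy i] at hi
        exact (Fin.castSucc_lt_last i).ne (x.injective (γ.injective hi)))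
      (fun hm => by
        obtain ⟨i, -, hi⟩ := Finset.mem_map.1 hm
        exact (Fin.castSucc_lt_last i).ne (y.injective hi))
    refine ⟨δ * γ, Γ.mul_mem hδ hγ, fun i => ?_⟩
    induction i using Fin.lastCases with
    | last => exact hab
    | cast i =>
      rw [Perm.mul_apply]
      refine (congrArg δ (hxy i)).trans (hδs _ ?_)
      exact Finset.mem_map_of_mem _ (Finset.mem_univ i)

theorem card_of_forall_eq_one (h : ∀ k < 5, Homogeneous (Fin 12) Γ k ∧
    ∃ s : Finset (Fin 12), s.card = k ∧ DvdOrbits Γ (12 - k) s)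
    (h1 : ∀ γ ∈ Γ, (∀ i : Fin 12, i < 5 → γ i = i) → γ = 1) : Nat.card Γ = 95040 := by
  let e : Fin 5 ↪ Fin 12 := Fin.castLEEmb (by norm_num)
  have hb : Function.Bijective fun γ : Γ => e.trans (γ : Perm (Fin 12)).toEmbedding := by
    refine ⟨fun γ δ hγ => ?_, fun x => ?_⟩
    · have := h1 (δ⁻¹ * γ : Γ) (δ⁻¹ * γ).2 fun i hi => by
        have := congrArg (fun x : Fin 5 ↪ Fin 12 => x ⟨i, hi⟩) hγ
        exact ((δ : Perm (Fin 12)).symm_apply_eq).2 this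
      have h2 : δ⁻¹ * γ = 1 := Subtype.ext this
      exact (inv_mul_eq_one.1 h2).symm
    · obtain ⟨γ, hγ, hx⟩ := exists_forall_apply_eq h 5 le_rfl e x
      exact ⟨⟨γ, hγ⟩, Function.Embedding.ext hx⟩
  rw [Nat.card_eq_of_bijective _ hb, Nat.card_eq_fintype_card, Fintype.card_embedding_eq]
  simp [Nat.descFactorial]

/-- The subset of `Fin 12` encoded by the binary digits of `m`. -/
def bitSet (m : ℕ) : Finset (Fin 12) := Finset.univ.filter fun i => m.testBit i

theorem mem_bitSet {m : ℕ} {i : Fin 12} : i ∈ bitSet m ↔ m.testBit i := by simp [bitSet]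

/-- The blocks of a Steiner system `S(5, 6, 12)`, encoded as binary numbers. -/
def hexads : List ℕ :=
  [63, 222, 237, 243, 349, 363, 374, 411, 430, 437, 455, 504, 591, 629, 634, 663, 683, 700,
    729, 742, 798, 807, 825, 851, 876, 909, 946, 970, 980, 993, 1115, 1127, 1148, 1167,
    1206, 1209, 1237, 1258, 1303, 1325, 1338, 1358, 1393, 1436, 1443, 1481, 1490, 1508,
    1565, 1582, 1587, 1622, 1641, 1690, 1701, 1731, 1740, 1776, 1803, 1844, 1861, 1880,
    1890, 1926, 1937, 1960, 2135, 2158, 2169, 2205, 2215, 2234, 2251, 2292, 2319, 2355,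
    2364, 2394, 2405, 2454, 2473, 2508, 2513, 2530, 2587, 2605, 2614, 2652, 2659, 2702,
    2737, 2757, 2770, 2792, 2837, 2858, 2886, 2889, 2928, 2947, 2968, 2980, 3102, 3115,
    3125, 3149, 3186, 3219, 3244, 3270, 3288, 3297, 3353, 3366, 3395, 3412, 3432, 3461,
    3466, 3504, 3591, 3640, 3658, 3665, 3684, 3721, 3732, 3746, 3852, 3858, 3873, 4032]

theorem card_bitSet_of_mem_hexads :
    ∀ m ∈ hexads, (bitSet (m &&& (m - 1))).card = 5 := by decide +kernel

theorem eq_of_mem_hexads : ∀ m ∈ hexads, ∀ n ∈ hexads,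
    n &&& (m &&& (m - 1)) = m &&& (m - 1) → n = m := by decide +kernel

theorem eq_of_mem_hexads_of_and : ∀ m ∈ hexads, m % 2 ^ 5 = 31 → m = 63 := by decide +kernel

theorem exists_separating_hexad : ∀ x y : Fin 12, 5 < x → 5 < y → x ≠ y →
    ∃ x' : Fin 12, 5 < x' ∧ x' ≠ x ∧ ∀ y' : Fin 12, y' ≠ y → 5 < y' →
      ∃ m ∈ hexads, m.testBit x ∧ m.testBit x' ∧
        ∀ n ∈ hexads, n.testBit y → n.testBit y' → n % 2 ^ 6 ≠ m % 2 ^ 6 := by decide +kernel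

theorem subset_bitSet_iff {t m : ℕ} (ht : t < 2 ^ 12) : bitSet t ⊆ bitSet m ↔ m &&& t = t := by
  refine ⟨fun h => Nat.eq_of_testBit_eq fun i => ?_, fun h i hi => ?_⟩
  · rw [Nat.testBit_and]
    rcases lt_or_ge i 12 with hi | hi
    · have := @h ⟨i, hi⟩
      simp only [mem_bitSet] at this
      grind
    · rw [Nat.testBit_lt_two_pow (ht.trans_le (Nat.pow_le_pow_right (by norm_num) hi)),
        Bool.and_false]
  · rw [mem_bitSet] at hi ⊢
    rw [← h, Nat.testBit_and] at hi
    grind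

theorem lt_of_mem_hexads : ∀ m ∈ hexads, m < 2 ^ 12 := by decide +kernel

/-- A permutation group whose stabilizers of sets of at most four points are transitive on the
remaining points, and which preserves a non-empty set of blocks of a Steiner system
`S(5, 6, 12)`, has order `95040`. -/
theorem card_of_hexads (h : ∀ k < 5, Homogeneous (Fin 12) Γ k ∧
    ∃ s : Finset (Fin 12), s.card = k ∧ DvdOrbits Γ (12 - k) s) (Z : Finset (Fin 12) → Prop)
    (hΓ : ∀ γ ∈ Γ, ∀ S, Z S → Z (S.map γ.toEmbedding))
    (hZ : ∀ S, Z S → ∃ m ∈ hexads, S = bitSet m) (hne : ∃ S, Z S) : Nat.card Γ = 95040 := by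
  have hom : Homogeneous (Fin 12) Γ 5 := (h 4 (by norm_num)).1.succ (h 4 (by norm_num)).2
  have hmem (m) (hm : m ∈ hexads) : Z (bitSet m) := by
    obtain ⟨S, hS⟩ := hne
    obtain ⟨n, hn, rfl⟩ := hZ S hS
    obtain ⟨γ, hγ, hst⟩ := hom _ _ (card_bitSet_of_mem_hexads n hn)
      (card_bitSet_of_mem_hexads m hm)
    have hS' := hΓ γ hγ _ hS
    obtain ⟨n', hn', hS''⟩ := hZ _ hS'
    rw [hS''] at hS'
    rwa [← eq_of_mem_hexads m hm n' hn'
      ((subset_bitSet_iff (Nat.and_lt_two_pow _ (by have := lt_of_mem_hexads m hm; omega))).1 ?_)]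
    rw [← hst, ← hS'']
    exact Finset.map_subset_map.2
      ((subset_bitSet_iff (Nat.and_lt_two_pow _ (by have := lt_of_mem_hexads n hn; omega))).2
        (by grind))
  refine card_of_forall_eq_one h fun γ hγ hfix => ?_
  have himage (m) (hm : m ∈ hexads) : ∃ n ∈ hexads, ∀ i, n.testBit (γ i) = m.testBit i := by
    obtain ⟨n, hn, hmn⟩ := hZ _ (hΓ γ hγ _ (hmem m hm))
    refine ⟨n, hn, fun i => ?_⟩
    rw [Bool.eq_iff_iff, ← mem_bitSet, ← mem_bitSet, ← hmn]
    exact Finset.mem_map' γ.toEmbedding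
  have hmod {m n : ℕ} (k : ℕ) (hk : k < 12) (hk' : ∀ i : Fin 12, i < k → γ i = i)
      (hmn : ∀ i : Fin 12, n.testBit (γ i) = m.testBit i) : n % 2 ^ k = m % 2 ^ k := by
    refine Nat.eq_of_testBit_eq fun i => ?_
    rw [Nat.testBit_mod_two_pow, Nat.testBit_mod_two_pow]
    rcases lt_or_ge i k with hi | hi
    · have := hmn ⟨i, hi.trans hk⟩
      rw [hk' ⟨i, hi.trans hk⟩ hi] at this
      rw [this]
    · simp [hi.not_gt]
  have h5 (i : Fin 12) (hi : i ≤ 5) : γ i = i := by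
    have hfix' (i : Fin 12) (hi : i < 5) : γ i = i := hfix i hi
    rcases hi.lt_or_eq with hi | rfl
    · exact hfix i hi
    obtain ⟨n, hn, hmn⟩ := himage 63 (by decide +kernel)
    have hn' := eq_of_mem_hexads_of_and n hn (hmod 5 (by norm_num) hfix' hmn)
    have h1 := hmn 5
    subst hn'
    have h2 : ∀ i : Fin 12, Nat.testBit 63 i = Nat.testBit 63 (5 : Fin 12) → i < 5 ∨ i = 5 := by
      decide
    refine (h2 _ h1).resolve_left fun h3 => ?_
    exact h3.ne (γ.injective (hfix' _ h3))
  have hlt {i : Fin 12} (hi : 5 < i) : 5 < γ i := by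
    by_contra! h3
    exact (h3.trans_lt hi).ne (γ.injective (h5 _ h3))
  refine Equiv.ext fun x => ?_
  rcases le_or_gt x 5 with hx | hx
  · exact h5 x hx
  by_contra hxy
  obtain ⟨x', hx', hne', hsep⟩ := exists_separating_hexad x (γ x) hx (hlt hx) (Ne.symm hxy)
  obtain ⟨m, hm, h1, h2, h3⟩ := hsep (γ x') (γ.injective.ne hne') (hlt hx')
  obtain ⟨n, hn, hmn⟩ := himage m hm
  refine h3 n hn (by rw [hmn, h1]) (by rw [hmn, h2]) ?_
  exact hmod 6 (by norm_num) (fun i hi => h5 i (Nat.lt_succ_iff.1 hi)) hmn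

end

end FB

namespace FB

/-- The value of `evalTerms` modulo `p`. -/
def evalTermsMod (p : ℕ) (x : List ℕ) : List (ℤ × List ℕ) → ℕ
  | [] => 0
  | t :: ts => ((t.1 % (p : ℤ)).toNat * (List.zipWith (· ^ ·) x t.2).prod +
      evalTermsMod p x ts) % p

/-- The signed power sum of the elements of a list modulo `p`, with signs given by the binary
digits of `m`. -/
def signedSumMod (p j : ℕ) : List ℕ → ℕ → ℕ
  | [], _ => 0
  | b :: l, m => ((2 * (m % 2) + (p - 1)) * b ^ j + signedSumMod p j l (m / 2)) % p

theorem evalTermsMod_lt (p : ℕ) [NeZero p] (x : List ℕ) (ts : List (ℤ × List ℕ)) :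
    evalTermsMod p x ts < p := by
  cases ts
  exacts [NeZero.pos p, Nat.mod_lt _ (NeZero.pos p)]

section

variable {R : Type} [CommRing R] {p : ℕ} [NeZero p]

theorem cast_evalTermsMod (hp : (p : R) = 0) (x : List ℕ) (ts : List (ℤ × List ℕ)) :
    (evalTermsMod p x ts : R) = evalTerms (x.map ((↑) : ℕ → R)) ts := by
  induction ts with
  | nil => simp [evalTermsMod, evalTerms]
  | cons t ts ih =>
    have h1 : (((t.1 % (p : ℤ)).toNat : ℕ) : R) = t.1 := by
      rw [← Int.cast_natCast, Int.toNat_of_nonneg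
        (Int.emod_nonneg _ (by exact_mod_cast NeZero.ne p)), Int.emod_def]
      simp [hp]
    have h2 (x e : List ℕ) : (((List.zipWith (· ^ ·) x e).prod : ℕ) : R) =
        (List.zipWith (· ^ ·) (x.map ((↑) : ℕ → R)) e).prod := by
      induction x generalizing e with
      | nil => simp
      | cons a x ih => cases e <;> simp [ih]
    rw [evalTermsMod, natCast_mod_of_eq_zero hp, Nat.cast_add, Nat.cast_mul, ih, h1, h2]
    simp [evalTerms]

theorem cast_signedSumMod (hp : (p : R) = 0) (j : ℕ) (l : List ℕ) (m : ℕ) :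
    (signedSumMod p j l m : R) =
      ∑ i : Fin l.length, (if m.testBit i then 1 else -1) * (l.get i : R) ^ j := by
  induction l generalizing m with
  | nil => simp [signedSumMod]
  | cons b l ih =>
    have h : ((p - 1 : ℕ) : R) = -1 := by
      rw [Nat.cast_sub (NeZero.one_le), hp]
      simp
    rw [signedSumMod, natCast_mod_of_eq_zero hp]
    push_cast
    rw [ih, h]
    refine Eq.trans ?_ (Fin.sum_univ_succ _).symm
    congr 1
    · rcases Nat.mod_two_eq_zero_or_one m with h | h <;> (simp [Nat.testBit_zero, h]; try ring)
    · simp [Nat.testBit_succ]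

end

/-- The roots of the defining polynomial at a totally split place of characteristic `739`. -/
def splitRoots : List ℕ := [186, 429, 486, 495, 654, 17, 206, 518, 635, 76, 214, 418]

theorem splitRoots_pow : ∀ b ∈ splitRoots,
    ((b : ℤ) ^ 12 - evalList (b : ℤ) (fList 739 357)) % 739 = 0 := by decide +kernel

theorem nodup_splitRoots : splitRoots.Nodup := by decide +kernel

/-- The value of `hexPoly` at the totally split place of characteristic `739`. -/
def hexValue (m : ℕ) : ℕ :=
  evalTermsMod 739 [1, signedSumMod 739 1 splitRoots m, signedSumMod 739 2 splitRoots m,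
    signedSumMod 739 3 splitRoots m, signedSumMod 739 4 splitRoots m,
    signedSumMod 739 5 splitRoots m, signedSumMod 739 6 splitRoots m] hexTerms

theorem mem_hexads_of_hexValue_eq_zero : ∀ a b : Fin 64, (bitSet (64 * (a : ℕ) + b)).card = 6 →
    hexValue (64 * (a : ℕ) + b) = 0 → 64 * (a : ℕ) + b ∈ hexads := by decide +kernel

section

variable {κ : Type} [Field κ] [CharP κ 739]

theorem natCast_splitRoots_injective :
    Function.Injective fun i : Fin 12 => ((splitRoots.get i : ℕ) : κ) := by
  intro i j h
  have hlt : ∀ b ∈ splitRoots, b < 739 := by decide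
  have := CharP.natCast_injOn_Iio κ 739 (hlt _ (splitRoots.get_mem i))
    (hlt _ (splitRoots.get_mem j)) h
  exact nodup_splitRoots.injective_get this

theorem eval_splitRoots (φ : ℤ[X] →+* κ) (hφ : φ X = (357 : ℕ)) (i : Fin 12) :
    (fPoly.map φ).eval ((splitRoots.get i : ℕ) : κ) = 0 := by
  have h0 : ((739 : ℕ) : κ) = 0 := CharP.cast_eq_zero κ 739
  rw [eval_map_fPoly_eq_zero_iff h0 (by norm_num) φ hφ, ← sub_eq_zero]
  obtain ⟨c, hc⟩ := Int.dvd_of_emod_eq_zero (splitRoots_pow _ (splitRoots.get_mem i))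
  have := congrArg (Int.castRingHom κ) hc
  rw [map_sub, map_pow, evalList_map, map_mul] at this
  simp only [eq_intCast, Int.cast_natCast] at this
  rw [this]
  have h1 : ((739 : ℤ) : κ) = 0 := by exact_mod_cast h0
  rw [h1, zero_mul]

theorem exists_mem_hexads {S : Finset (Fin 12)} (hS : S.card = 6)
    (h : hexPoly (1 : κ) S (fun i => ((splitRoots.get i : ℕ) : κ)) = 0) :
    ∃ m ∈ hexads, S = bitSet m := by
  have h0 : ((739 : ℕ) : κ) = 0 := CharP.cast_eq_zero κ 739
  obtain ⟨m, hm, rfl⟩ : ∃ m < 2 ^ 12, bitSet m = S := by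
    refine ⟨Nat.ofBits fun i : Fin 12 => decide (i ∈ S), Nat.ofBits_lt_two_pow _, ?_⟩
    ext i
    rw [mem_bitSet, Nat.testBit_ofBits_lt _ _ i.2]
    simp
  refine ⟨m, ?_, rfl⟩
  have h1 (j : ℕ) : ((signedSumMod 739 j splitRoots m : ℕ) : κ) =
      signedPowerSum (bitSet m) (fun i => ((splitRoots.get i : ℕ) : κ)) j := by
    rw [cast_signedSumMod h0]
    refine Finset.sum_congr rfl fun (i : Fin 12) _ => congrArg (· * _) ?_
    exact if_congr mem_bitSet.symm rfl rfl
  have h2 : ((hexValue m : ℕ) : κ) = 0 := by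
    rw [hexValue, cast_evalTermsMod h0]
    simp only [List.map_cons, List.map_nil, h1, Nat.cast_one]
    exact h
  have h3 : hexValue m = 0 :=
    CharP.natCast_injOn_Iio κ 739 (evalTermsMod_lt _ _ _) (Set.mem_Iio.2 (by norm_num))
      (h2.trans Nat.cast_zero.symm)
  have h4 : 64 * (m / 64) + m % 64 = m := Nat.div_add_mod m 64
  have := mem_hexads_of_hexValue_eq_zero ⟨m / 64, by omega⟩ ⟨m % 64, by omega⟩
  simp only [h4] at this
  exact this hS h3

end

namespace Roots

/-- Renumbering of the roots. -/
def reindex {L : Type} [Field L] [Algebra ℤ[X] L] (b : Roots L) (e : Equiv.Perm (Fin 12)) :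
    Roots L where
  root i := b.root (e i)
  prod_eq := b.prod_eq.trans (Equiv.prod_comp e fun i => X - C (b.root i : L)).symm
  inj := b.inj.comp e.injective

variable {L : Type} [Field L] [Algebra (RatFunc ℚ) L] [Algebra ℤ[X] L]
    [IsScalarTower ℤ[X] (RatFunc ℚ) L] [FiniteDimensional (RatFunc ℚ) L]
    [IsGalois (RatFunc ℚ) L]

theorem exists_roots_of_hexPoly_eq_zero (b : Roots L) : ∃ b : Roots L,
    ∀ S : Finset (Fin 12), S.card = 6 → hexPoly 1 S b.root = 0 → ∃ m ∈ hexads, S = bitSet m := by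
  have : Fact (Nat.Prime 739) := ⟨by norm_num⟩
  obtain ⟨κ, _, _, ψ, σ, hψ, -⟩ := exists_frobenius_at L 739 357
  have hφ : (ψ.comp (algebraMap ℤ[X] _)) X = (357 : ℕ) := hψ
  have h (i : Fin 12) : ∃ j, ψ (b.root j) = (splitRoots.get i : ℕ) := by
    have := eval_splitRoots _ hφ i
    rw [b.prod_eq_map ψ, eval_prod, Finset.prod_eq_zero_iff] at this
    obtain ⟨j, -, hj⟩ := this
    rw [eval_sub, eval_X, eval_C, sub_eq_zero] at hj
    exact ⟨j, hj.symm⟩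
  choose e he using h
  have hinj : Function.Injective e := fun i j hij =>
    natCast_splitRoots_injective (κ := κ) ((he i).symm.trans ((congrArg (fun k => ψ (b.root k)) hij).trans
      (he j)))
  refine ⟨b.reindex (Equiv.ofBijective e (Finite.injective_iff_bijective.1 hinj)),
    fun S hS h => exists_mem_hexads (κ := κ) hS ?_⟩
  have := congrArg ψ h
  rw [map_hexPoly, map_one, map_zero] at this
  rw [← this]
  congr 1
  exact funext fun i => (he i).symm

theorem card_perm_range (b : Roots L) : ∃ b : Roots L, Nat.card b.perm.range = 95040 := by
  obtain ⟨b, hb⟩ := b.exists_roots_of_hexPoly_eq_zero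
  obtain ⟨c, hc, hc', hc1⟩ := b.exists_perm_pow_eleven
  obtain ⟨t, ht, ht', ht2, ht5⟩ := b.exists_perm_pow_ten
  obtain ⟨g, hg, hg', hg1, hg2, hg4⟩ := b.exists_perm_pow_eight
  obtain ⟨u, hu, hu', hu2, hu3⟩ := b.exists_perm_pow_six
  refine ⟨b, card_of_hexads (dvdOrbits_of_fixedSets hg hg' hg2 hg4 hc hc' hc1 ht ht' ht2 ht5 hg1
    hu hu' hu2 hu3) (fun S => S.card = 6 ∧ hexPoly 1 S b.root = 0) ?_
    (fun S hS => hb S hS.1 hS.2) b.exists_hexPoly_eq_zero⟩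
  rintro _ ⟨σ, rfl⟩ S ⟨hS, h⟩
  exact ⟨(Finset.card_map _).trans hS, b.hexPoly_perm σ h⟩

end Roots

section

variable {L : Type} [Field L] [Algebra (RatFunc ℚ) L] [Algebra ℤ[X] L]
    [IsScalarTower ℤ[X] (RatFunc ℚ) L] [FiniteDimensional (RatFunc ℚ) L]
    [IsGalois (RatFunc ℚ) L]

theorem exists_roots (h : (fPoly.map (algebraMap ℤ[X] L)).Splits) : Nonempty (Roots L) := by
  have hm := fPoly_monic.map (algebraMap ℤ[X] L)
  have hprod := h.eq_prod_roots_of_monic hm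
  set r := (fPoly.map (algebraMap ℤ[X] L)).roots with hr
  have hcard : r.card = 12 := by
    rw [hr, ← h.natDegree_eq_card_roots, fPoly_monic.natDegree_map, natDegree_fPoly]
  have hinteg (x : L) (hx : x ∈ r) : IsIntegral ℤ[X] x :=
    ⟨fPoly, fPoly_monic, by rw [← eval_map]; exact isRoot_of_mem_roots hx⟩
  have hlen : r.toList.length = 12 := by rw [Multiset.length_toList, hcard]
  let root (i : Fin 12) : integralClosure ℤ[X] L := ⟨r.toList.get (i.cast hlen.symm),
    hinteg _ (Multiset.mem_toList.1 (List.get_mem _ _))⟩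
  have hroot : fPoly.map (algebraMap ℤ[X] L) = ∏ i, (X - C (root i : L)) := by
    rw [hprod, ← Multiset.coe_toList r, Multiset.map_coe, Multiset.prod_coe,
      ← List.ofFn_get r.toList, List.map_ofFn, List.prod_ofFn]
    exact ((finCongr hlen.symm).prod_comp _).symm
  have : Fact (Nat.Prime 7) := ⟨by norm_num⟩
  obtain ⟨κ, _, _, ψ, -, hψ, -⟩ := exists_frobenius_at L 7 1
  have hφ : (ψ.comp (algebraMap ℤ[X] _)) X = (1 : ℕ) := hψ
  have hinj := injective_roots _ hφ _ (map_comp_eq_prod hroot ψ) (k := 11) (by norm_num)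
    (by decide +kernel)
  exact ⟨root, hroot, fun i j hij => hinj (congrArg ψ hij)⟩

theorem card_gal_of_comp_eq {f : (RatFunc ℚ)[X]}
    (hf : (fPoly.map (algebraMap ℤ[X] (RatFunc ℚ))).comp (C 3 * X) = C (3 ^ 11) * f) :
    Nat.card f.Gal = 95040 := by
  let L := f.SplittingField
  have : IsGalois (RatFunc ℚ) L := { }
  have hfL : (fPoly.map (algebraMap ℤ[X] L)).comp (C 3 * X) =
      C (3 ^ 11) * f.map (algebraMap (RatFunc ℚ) L) := by
    have := congrArg (Polynomial.map (algebraMap (RatFunc ℚ) L)) hf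
    rw [Polynomial.map_comp, Polynomial.map_map, ← IsScalarTower.algebraMap_eq] at this
    rwa [Polynomial.map_mul, Polynomial.map_mul, map_X, map_C, map_C, map_pow, map_ofNat] at this
  have h3 : (3 : L) ≠ 0 := by norm_num
  obtain ⟨b⟩ : Nonempty (Roots L) := by
    refine exists_roots ?_
    have h : (fPoly.map (algebraMap ℤ[X] L)) =
        (C (3 ^ 11) * f.map (algebraMap (RatFunc ℚ) L)).comp (C 3⁻¹ * X) := by
      rw [← hfL, comp_assoc]
      simp [← mul_assoc, ← C_mul, h3]
    rw [h]
    exact ((Splits.C _).mul (SplittingField.splits f)).comp_of_natDegree_le_one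
      ((natDegree_C_mul_le _ _).trans natDegree_X_le)
  obtain ⟨b, hb⟩ := b.card_perm_range
  rw [← hb]
  refine Nat.card_congr (MonoidHom.ofInjective (f := b.perm) ?_).toEquiv
  rw [injective_iff_map_eq_one]
  intro σ hσ
  refine Gal.ext (p := f) fun x hx => ?_
  have h0 : (f.map (algebraMap (RatFunc ℚ) L)).eval x = 0 := by
    rw [eval_map_algebraMap]
    exact aeval_eq_zero_of_mem_rootSet hx
  obtain ⟨i, hi⟩ := (b.isRoot_iff (3 * x)).1 (by
    have := congrArg (eval x) hfL
    rwa [eval_comp, eval_mul, eval_mul, h0, mul_zero, eval_C, eval_X] at this)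
  have h1 := b.root_perm σ i
  rw [hσ, Equiv.Perm.one_apply, hi, map_mul, map_ofNat] at h1
  exact (mul_left_cancel₀ h3 h1).symm

end

end FB

/-- The polynomial `f_B(s,x)` of Matzat--Zeh-Marschke has Galois group
over `ℚ(s)` of order `95040`, the order of the Mathieu group `M₁₂`. -/
theorem galois_group_of_fB_has_card_M12 :
    let s : Polynomial (RatFunc ℚ) := C RatFunc.X
    let fB : Polynomial (RatFunc ℚ) :=
      3 * X ^ 12 + 100 * X ^ 11 + 1350 * X ^ 10 + 9300 * X ^ 9 + 32925 * X ^ 8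
        + 45000 * X ^ 7 - 43500 * X ^ 6 - 147000 * X ^ 5 + 46125 * X ^ 4
        + 172500 * X ^ 3 - 16250 * X ^ 2 + 22500 * X + 1875
        - s * 2 ^ 11 * 5 ^ 2 * X ^ 2
    Nat.card fB.Gal = 95040 := by
  intro s fB
  refine FB.card_gal_of_comp_eq ?_
  have hX : algebraMap ℤ[X] (RatFunc ℚ) X = RatFunc.X := by
    rw [FB.algebraMap_ratFunc, map_X, RatFunc.algebraMap_X]
  rw [FB.map_fPoly, hX, ← coe_compRingHom_apply, FB.map_evalTerms]
  simp only [FB.evalTerms, FB.fTerms, List.map_cons, List.map_nil, List.zipWith_cons_cons,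
    List.zipWith_nil_left, List.prod_cons, List.prod_nil, List.sum_cons, List.sum_nil,
    coe_compRingHom_apply, C_comp, X_comp, fB, s, map_ofNat, map_pow]
  push_cast
  ring
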